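/- arXiv:2501.00998 — 2 statements merged into one kernel-verified Lean document; each statement's English description precedes it below -/
import Mathlib

section
/- Assume 0 < 1/n ≪ δ ≪ 1 and 0 ≤ γ ≤ 3δ. Let 𝒞 be a set of n colors and 𝒟 = {D_i : i ∈ 𝒞} a collection of digraphs on a common vertex set V of size n with δ⁰(𝒟) ≥ ⌈n/2⌉. Let A ∪ B be a partition of V with |A| = ⌈n/2⌉ + γn, and let 𝒞' ∪ 𝒞'' be a partition of 𝒞 with |𝒞''| ≤ δn. If D_i[B] has no edges for all i ∈ 𝒞', then 𝒟 contains a transversal directed Hamilton cycle. -/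
open Finset

/-- Out-degree of a vertex in a digraph given as a relation on `Fin n`. -/
noncomputable def outDeg {n : ℕ} (D : Fin n → Fin n → Prop) (v : Fin n) : ℕ :=
  Nat.card {w : Fin n // D v w}

/-- In-degree of a vertex in a digraph given as a relation on `Fin n`. -/
noncomputable def inDeg {n : ℕ} (D : Fin n → Fin n → Prop) (v : Fin n) : ℕ :=
  Nat.card {w : Fin n // D w v}

namespace TransversalHamilton

section Forest

open scoped Classical

variable {V C : Type*}

/-- Colours of a set of coloured edges `(i, u, v)`. -/
noncomputable def cols (S : Finset (C × V × V)) : Finset C := S.image fun e => e.1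

/-- Tails of a set of coloured edges. -/
noncomputable def srcs (S : Finset (C × V × V)) : Finset V := S.image fun e => e.2.1

/-- Heads of a set of coloured edges. -/
noncomputable def tgts (S : Finset (C × V × V)) : Finset V := S.image fun e => e.2.2

/-- The number of edges inside `A` minus the number of edges inside `Aᶜ`. -/
noncomputable def bal (A : Finset V) (S : Finset (C × V × V)) : ℤ :=
  ∑ e ∈ S, ((if e.2.1 ∈ A then 1 else 0) + (if e.2.2 ∈ A then 1 else 0) - 1)

/-- A rainbow linear forest: the components are directed paths, witnessed by an injective `key`
in whose order every edge joins two consecutive vertices. -/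
structure RainbowForest (D : C → V → V → Prop) (S : Finset (C × V × V)) : Prop where
  valid : ∀ e ∈ S, D e.1 e.2.1 e.2.2
  inj_col : Set.InjOn (fun e : C × V × V => e.1) S
  inj_src : Set.InjOn (fun e : C × V × V => e.2.1) S
  inj_tgt : Set.InjOn (fun e : C × V × V => e.2.2) S
  exists_key : ∃ key : V → ℚ, Function.Injective key ∧ ∀ e ∈ S, key e.2.1 < key e.2.2 ∧
    ∀ z, ¬ (key e.2.1 < key z ∧ key z < key e.2.2)

/-- Reversal of a set of coloured edges. -/
noncomputable def rev (S : Finset (C × V × V)) : Finset (C × V × V) :=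
  S.image fun e => (e.1, e.2.2, e.2.1)

theorem mem_rev {S : Finset (C × V × V)} {i : C} {u v : V} :
    (i, u, v) ∈ rev S ↔ (i, v, u) ∈ S := by
  simp only [rev, mem_image, Prod.mk.injEq, Prod.exists]
  constructor
  · rintro ⟨a, b, c, h, rfl, rfl, rfl⟩; exact h
  · intro h; exact ⟨i, v, u, h, rfl, rfl, rfl⟩

theorem mem_cols {S : Finset (C × V × V)} {i : C} : i ∈ cols S ↔ ∃ u v, (i, u, v) ∈ S := by
  simp [cols]

theorem mem_srcs {S : Finset (C × V × V)} {u : V} : u ∈ srcs S ↔ ∃ i v, (i, u, v) ∈ S := by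
  simp [srcs]

theorem mem_tgts {S : Finset (C × V × V)} {v : V} : v ∈ tgts S ↔ ∃ i u, (i, u, v) ∈ S := by
  simp [tgts]

theorem rev_rev (S : Finset (C × V × V)) : rev (rev S) = S := by
  ext ⟨i, u, v⟩; simp [mem_rev]

theorem cols_rev (S : Finset (C × V × V)) : cols (rev S) = cols S := by
  ext i; simp only [mem_cols, mem_rev]; exact exists_comm

theorem srcs_rev (S : Finset (C × V × V)) : srcs (rev S) = tgts S := by
  ext i; simp only [mem_srcs, mem_tgts, mem_rev]

theorem tgts_rev (S : Finset (C × V × V)) : tgts (rev S) = srcs S := by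
  ext i; simp only [mem_srcs, mem_tgts, mem_rev]

theorem rev_injective :
    Function.Injective (fun e : C × V × V => (e.1, e.2.2, e.2.1)) := by
  rintro ⟨a, b, c⟩ ⟨a', b', c'⟩ h
  simp only [Prod.mk.injEq] at h ⊢
  tauto

theorem card_rev (S : Finset (C × V × V)) : (rev S).card = S.card :=
  card_image_of_injective _ rev_injective

theorem rev_mono {S T : Finset (C × V × V)} (h : S ⊆ T) : rev S ⊆ rev T :=
  image_subset_image h

theorem bal_rev (A : Finset V) (S : Finset (C × V × V)) : bal A (rev S) = bal A S := by
  rw [bal, rev, sum_image fun _ _ _ _ h => rev_injective h, bal]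
  refine sum_congr rfl fun e _ => ?_
  ring

theorem RainbowForest.rev {D : C → V → V → Prop} {S : Finset (C × V × V)}
    (h : RainbowForest D S) : RainbowForest (fun i u v => D i v u) (rev S) := by
  refine ⟨?_, ?_, ?_, ?_, ?_⟩
  · rintro ⟨i, u, v⟩ he
    exact h.valid _ (mem_rev.1 he)
  · rintro ⟨i, u, v⟩ he ⟨i', u', v'⟩ he' heq
    have := h.inj_col (mem_rev.1 he) (mem_rev.1 he') heq
    simp only [Prod.mk.injEq] at this ⊢; tauto
  · rintro ⟨i, u, v⟩ he ⟨i', u', v'⟩ he' heq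
    have := h.inj_tgt (mem_rev.1 he) (mem_rev.1 he') heq
    simp only [Prod.mk.injEq] at this ⊢; tauto
  · rintro ⟨i, u, v⟩ he ⟨i', u', v'⟩ he' heq
    have := h.inj_src (mem_rev.1 he) (mem_rev.1 he') heq
    simp only [Prod.mk.injEq] at this ⊢; tauto
  · obtain ⟨key, hinj, hkey⟩ := h.exists_key
    refine ⟨fun v => - key v, fun a b hab => hinj (neg_injective hab), ?_⟩
    rintro ⟨i, u, v⟩ he
    have := hkey _ (mem_rev.1 he)
    simp only [neg_lt_neg_iff] at this ⊢
    exact ⟨this.1, fun z hz => this.2 z ⟨hz.2, hz.1⟩⟩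

theorem cols_insert (i : C) (u v : V) (S : Finset (C × V × V)) :
    cols (insert (i, u, v) S) = insert i (cols S) := image_insert _ _ _

theorem srcs_insert (i : C) (u v : V) (S : Finset (C × V × V)) :
    srcs (insert (i, u, v) S) = insert u (srcs S) := image_insert _ _ _

theorem tgts_insert (i : C) (u v : V) (S : Finset (C × V × V)) :
    tgts (insert (i, u, v) S) = insert v (tgts S) := image_insert _ _ _

theorem notMem_of_notMem_cols {S : Finset (C × V × V)} {i : C} (hi : i ∉ cols S) (u v : V) :
    (i, u, v) ∉ S := fun h => hi (mem_cols.2 ⟨u, v, h⟩)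

theorem bal_insert (A : Finset V) {i : C} {u v : V} {S : Finset (C × V × V)} (hi : i ∉ cols S) :
    bal A (insert (i, u, v) S) =
      bal A S + ((if u ∈ A then 1 else 0) + (if v ∈ A then 1 else 0) - 1) := by
  rw [bal, sum_insert (notMem_of_notMem_cols hi u v), bal]
  ring

theorem card_insert' {i : C} {u v : V} {S : Finset (C × V × V)} (hi : i ∉ cols S) :
    (insert (i, u, v) S).card = S.card + 1 := card_insert_of_notMem (notMem_of_notMem_cols hi u v)

theorem card_cols_le (S : Finset (C × V × V)) : (cols S).card ≤ S.card := card_image_le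

theorem card_srcs_le (S : Finset (C × V × V)) : (srcs S).card ≤ S.card := card_image_le

theorem card_tgts_le (S : Finset (C × V × V)) : (tgts S).card ≤ S.card := card_image_le

theorem cols_mono {S T : Finset (C × V × V)} (h : S ⊆ T) : cols S ⊆ cols T :=
  image_subset_image h

theorem srcs_mono {S T : Finset (C × V × V)} (h : S ⊆ T) : srcs S ⊆ srcs T :=
  image_subset_image h

theorem tgts_mono {S T : Finset (C × V × V)} (h : S ⊆ T) : tgts S ⊆ tgts T :=
  image_subset_image h

theorem RainbowForest.empty (D : C → V → V → Prop) (h : Nonempty (V ↪ ℚ)) :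
    RainbowForest D ∅ := by
  obtain ⟨f⟩ := h
  exact ⟨by simp, by simp, by simp, by simp, f, f.injective, by simp⟩

theorem RainbowForest.mono {D D' : C → V → V → Prop} {S : Finset (C × V × V)}
    (h : RainbowForest D S) (hD : ∀ i u v, D i u v → D' i u v) : RainbowForest D' S :=
  ⟨fun e he => hD _ _ _ (h.valid e he), h.inj_col, h.inj_src, h.inj_tgt, h.exists_key⟩

theorem injOn_insert_of_notMem {α β : Type*} [DecidableEq α] [DecidableEq β] {f : α → β} {S : Finset α} {e : α}
    (h : Set.InjOn f S) (he : f e ∉ S.image f) : Set.InjOn f (insert e S : Finset α) := by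
  have he' : e ∉ S := fun h => he (mem_image_of_mem _ h)
  rw [coe_insert, Set.injOn_insert (by simpa using he')]
  exact ⟨h, by simpa using he⟩

theorem RainbowForest.insert_of_fresh_head [Finite V] {D : C → V → V → Prop} {S : Finset (C × V × V)}
    (h : RainbowForest D S) {i : C} {u v : V} (hD : D i u v) (hi : i ∉ cols S)
    (hu : u ∉ srcs S) (hv : v ∉ tgts S) (huv : u ≠ v) (hv' : v ∉ srcs S) :
    RainbowForest D (insert (i, u, v) S) := by
  cases nonempty_fintype V
  refine ⟨?_, injOn_insert_of_notMem (e := (i, u, v)) h.inj_col hi,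
    injOn_insert_of_notMem (e := (i, u, v)) h.inj_src hu,
    injOn_insert_of_notMem (e := (i, u, v)) h.inj_tgt hv, ?_⟩
  · intro e he
    rcases mem_insert.1 he with rfl | he
    · exact hD
    · exact h.valid e he
  obtain ⟨key, hinj, hkey⟩ := h.exists_key
  obtain ⟨q, hq1, hq2⟩ := Order.exists_between_finsets {key u}
    ((univ.filter fun z => key u < key z).image key) (by
      intro x hx y hy
      simp only [mem_singleton, mem_image, mem_filter, mem_univ, true_and] at hx hy
      obtain ⟨z, hz, rfl⟩ := hy
      rwa [hx])
  have hq1 : key u < q := hq1 _ (mem_singleton_self _)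
  have hq2 : ∀ z, key u < key z → q < key z := fun z hz =>
    hq2 _ (mem_image_of_mem _ (by simpa using hz))
  have hne : ∀ z, key z ≠ q := by
    intro z hz
    have := hq2 z (by rw [hz]; exact hq1)
    rw [hz] at this
    exact lt_irrefl _ this
  refine ⟨Function.update key v q, ?_, ?_⟩
  · intro a b hab
    by_cases ha : a = v <;> by_cases hb : b = v
    · rw [ha, hb]
    · subst ha; simp [Function.update_of_ne hb] at hab; exact (hne _ hab.symm).elim
    · subst hb; simp [Function.update_of_ne ha] at hab; exact (hne _ hab).elim
    · rw [Function.update_of_ne ha, Function.update_of_ne hb] at hab; exact hinj hab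
  · intro e he
    rcases mem_insert.1 he with rfl | he
    · simp only [Function.update_self, Function.update_of_ne huv]
      refine ⟨hq1, fun z hz => ?_⟩
      by_cases hzv : z = v
      · subst hzv; simp at hz
      · rw [Function.update_of_ne hzv] at hz
        exact lt_asymm hz.2 (hq2 z hz.1)
    · obtain ⟨j, x, y⟩ := e
      have hx : x ≠ v := fun hx => hv' (mem_srcs.2 ⟨j, y, hx ▸ he⟩)
      have hy : y ≠ v := fun hy => hv (mem_tgts.2 ⟨j, x, hy ▸ he⟩)
      have hxu : x ≠ u := fun hx => hu (mem_srcs.2 ⟨j, y, hx ▸ he⟩)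
      have hk := hkey _ he
      simp only [Function.update_of_ne hx, Function.update_of_ne hy] at hk ⊢
      refine ⟨hk.1, fun z hz => ?_⟩
      by_cases hzv : z = v
      · subst hzv
        simp only [Function.update_self] at hz
        have h1 : key x < key u := by
          refine lt_of_le_of_ne (not_lt.1 fun hlt => lt_asymm hz.1 (hq2 _ hlt)) fun h => hxu (hinj h)
        exact hk.2 u ⟨h1, hq1.trans hz.2⟩
      · rw [Function.update_of_ne hzv] at hz
        exact hk.2 z hz

end Forest

theorem exists_perm_of_key {V : Type*} (T : Finset V) (key : V → ℚ)
    (hkey : Function.Injective key) :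
    ∃ ρ : Equiv.Perm V, (∀ x, x ∉ T → ρ x = x) ∧ ρ.IsCycleOn (T : Set V) ∧
      ∀ x ∈ T, ∀ y ∈ T, key x < key y → (∀ z, ¬ (key x < key z ∧ key z < key y)) → ρ x = y := by
  let : LinearOrder V := LinearOrder.lift' key hkey
  have hlt : ∀ a b : V, a < b ↔ key a < key b := fun a b => Iff.rfl
  have hnd : (T.sort (· ≤ ·)).Nodup := T.sort_nodup _
  have hmem : ∀ x, x ∈ T.sort (· ≤ ·) ↔ x ∈ T := fun x => mem_sort _
  have hsm : StrictMono (T.sort (· ≤ ·)).get := (sortedLT_sort T).strictMono_get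
  refine ⟨(T.sort (· ≤ ·)).formPerm, ?_, ?_, ?_⟩
  · intro x hx
    exact List.formPerm_apply_of_notMem (by rwa [hmem])
  · have := hnd.isCycleOn_formPerm
    convert this using 1
    ext x
    simp
  · intro x hx y hy hxy hz
    obtain ⟨i, rfl⟩ := List.get_of_mem ((hmem x).2 hx)
    obtain ⟨j, rfl⟩ := List.get_of_mem ((hmem y).2 hy)
    rw [← hlt, hsm.lt_iff_lt] at hxy
    have hj : j.1 = i.1 + 1 := by
      by_contra hne
      have hij : i.1 < j.1 := hxy
      have hjl := j.2
      have hlen : i.1 + 1 < (T.sort (· ≤ ·)).length := by omega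
      refine hz ((T.sort (· ≤ ·)).get ⟨i.1 + 1, hlen⟩) ⟨?_, ?_⟩
      · rw [← hlt, hsm.lt_iff_lt, Fin.lt_def]; simp
      · rw [← hlt, hsm.lt_iff_lt, Fin.lt_def]; simp; omega
    have hlen : i.1 + 1 < (T.sort (· ≤ ·)).length := hj ▸ j.2
    have := List.formPerm_apply_lt_getElem _ hnd i.1 hlen
    simp only [List.get_eq_getElem, hj]
    exact this

theorem exists_transversal_of_isCycleOn {n : ℕ} (hn : 0 < n) (D : Fin n → Fin n → Fin n → Prop)
    (τ : Equiv.Perm (Fin n)) (hτ : τ.IsCycleOn Set.univ) (col : Fin n → Fin n)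
    (hcol : Function.Bijective col) (hD : ∀ v, D (col v) v (τ v)) :
    ∃ σ φ : Fin n ≃ Fin n, ∀ k : Fin n, D (φ k) (σ k) (σ (finRotate n k)) := by
  obtain ⟨m, rfl⟩ : ∃ m, n = m + 1 := ⟨n - 1, by omega⟩
  have hτ' : τ.IsCycleOn ((univ : Finset (Fin (m + 1))) : Set (Fin (m + 1))) := by simpa using hτ
  have hbij : Function.Bijective (fun k : Fin (m + 1) => (τ ^ (k : ℕ)) 0) := by
    refine Finite.surjective_iff_bijective.1 fun y => ?_
    obtain ⟨k, hk, hk'⟩ := hτ'.exists_pow_eq (mem_univ 0) (mem_univ y)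
    exact ⟨⟨k, by simpa using hk⟩, hk'⟩
  refine ⟨Equiv.ofBijective _ hbij, (Equiv.ofBijective _ hbij).trans (Equiv.ofBijective _ hcol),
    fun k => ?_⟩
  have : (τ ^ ((finRotate (m + 1) k : Fin (m + 1)) : ℕ)) 0 = τ ((τ ^ (k : ℕ)) 0) := by
    rw [← Equiv.Perm.mul_apply, ← pow_succ']
    by_cases hk : k = Fin.last m
    · subst hk
      have := hτ'.pow_card_apply (mem_univ 0)
      simp only [card_univ, Fintype.card_fin] at this
      simp [this]
    · rw [coe_finRotate_of_ne_last hk]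
  simp only [Equiv.ofBijective_apply, Equiv.trans_apply, this]
  exact hD _

section Assembly

open scoped Classical

variable {V C : Type*}

theorem RainbowForest.card_srcs {D : C → V → V → Prop} {S : Finset (C × V × V)}
    (h : RainbowForest D S) : (srcs S).card = S.card := card_image_of_injOn h.inj_src

theorem RainbowForest.card_cols {D : C → V → V → Prop} {S : Finset (C × V × V)}
    (h : RainbowForest D S) : (cols S).card = S.card := card_image_of_injOn h.inj_col

theorem RainbowForest.bal_eq {D : C → V → V → Prop} {S : Finset (C × V × V)}
    (h : RainbowForest D S) (A : Finset V) :
    bal A S = (A ∩ srcs S).card + (A ∩ tgts S).card - S.card := by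
  have h1 : (A ∩ srcs S).card = (S.filter fun e => e.2.1 ∈ A).card := by
    rw [inter_comm, ← filter_mem_eq_inter, srcs, filter_image,
      card_image_of_injOn (h.inj_src.mono fun x hx => (mem_filter.1 hx).1)]
  have h2 : (A ∩ tgts S).card = (S.filter fun e => e.2.2 ∈ A).card := by
    rw [inter_comm, ← filter_mem_eq_inter, tgts, filter_image,
      card_image_of_injOn (h.inj_tgt.mono fun x hx => (mem_filter.1 hx).1)]
  rw [bal, h1, h2, sum_sub_distrib, sum_add_distrib]
  simp

theorem exists_forest_with_gadgets [Finite V] {M : ℕ} {D : C → V → V → Prop}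
    {S : Finset (C × V × V)}
    (hS : RainbowForest D S) (β : Fin M × Bool → V) (hβ : Function.Injective β)
    (κ : Fin M × Bool → C) (hκ : Function.Injective κ) (J : Finset (Fin M))
    (hJ : ∀ j ∈ J, (∀ t, β (j, t) ∉ srcs S ∪ tgts S) ∧ ∀ t, κ (j, t) ∉ cols S) :
    ∃ S', RainbowForest (fun _ _ _ => True) S' ∧ S ⊆ S' ∧
      (∀ j ∈ J, (κ (j, false), β (j, false), β (j, true)) ∈ S') ∧
      ∀ e ∈ S', e ∈ S ∨ ∃ j ∈ J, e = (κ (j, false), β (j, false), β (j, true)) := by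
  induction J using Finset.induction_on with
  | empty => exact ⟨S, hS.mono (by simp), Subset.rfl, by simp, by simp⟩
  | insert j J hj ih =>
    obtain ⟨S', h1, h2, h3, h4⟩ := ih fun j hj => hJ j (mem_insert_of_mem hj)
    have hJj := hJ j (mem_insert_self _ _)
    have hne : ∀ j' ∈ J, j' ≠ j := fun j' h h' => hj (h' ▸ h)
    refine ⟨insert (κ (j, false), β (j, false), β (j, true)) S',
      h1.insert_of_fresh_head trivial ?_ ?_ ?_ ?_ ?_, h2.trans (subset_insert _ _), ?_, ?_⟩
    · intro hmem
      obtain ⟨u, v, he⟩ := mem_cols.1 hmem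
      rcases h4 _ he with he | ⟨j', hj', he⟩
      · exact hJj.2 false (mem_cols.2 ⟨_, _, he⟩)
      · have := hκ (Prod.mk.inj he).1
        exact hne j' hj' (by simpa using this.symm)
    · intro hmem
      obtain ⟨i, v, he⟩ := mem_srcs.1 hmem
      rcases h4 _ he with he | ⟨j', hj', he⟩
      · exact hJj.1 false (mem_union_left _ (mem_srcs.2 ⟨_, _, he⟩))
      · have := hβ (Prod.mk.inj (Prod.mk.inj he).2).1
        exact hne j' hj' (by simpa using this.symm)
    · intro hmem
      obtain ⟨i, u, he⟩ := mem_tgts.1 hmem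
      rcases h4 _ he with he | ⟨j', hj', he⟩
      · exact hJj.1 true (mem_union_right _ (mem_tgts.2 ⟨_, _, he⟩))
      · have := hβ (Prod.mk.inj (Prod.mk.inj he).2).2
        exact hne j' hj' (by simpa using this.symm)
    · exact fun h => by simpa using hβ h
    · intro hmem
      obtain ⟨i, v, he⟩ := mem_srcs.1 hmem
      rcases h4 _ he with he | ⟨j', hj', he⟩
      · exact hJj.1 true (mem_union_left _ (mem_srcs.2 ⟨_, _, he⟩))
      · have := hβ (Prod.mk.inj (Prod.mk.inj he).2).1
        simp at this
    · intro j' hj'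
      rcases mem_insert.1 hj' with rfl | hj'
      · exact mem_insert_self _ _
      · exact mem_insert_of_mem (h3 j' hj')
    · intro e he
      rcases mem_insert.1 he with rfl | he
      · exact Or.inr ⟨j, mem_insert_self _ _, rfl⟩
      · rcases h4 e he with h | ⟨j', hj', h⟩
        · exact Or.inl h
        · exact Or.inr ⟨j', mem_insert_of_mem hj', h⟩

theorem card_filter_exists_mem_le {α : Type*} {M : ℕ} (β : Fin M × Bool → α)
    (hβ : Function.Injective β) (X : Finset α) :
    (univ.filter fun j => ∃ t, β (j, t) ∈ X).card ≤ X.card := by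
  have h1 : (univ.filter fun j => ∃ t, β (j, t) ∈ X) ⊆
      (univ.filter fun x => β x ∈ X).image Prod.fst := by
    intro j hj
    obtain ⟨t, ht⟩ := (mem_filter.1 hj).2
    exact mem_image.2 ⟨(j, t), by simpa using ht, rfl⟩
  refine (card_le_card h1).trans (card_image_le.trans ?_)
  exact card_le_card_of_injOn β (by intro x hx; simpa using hx) hβ.injOn

/-- A cyclic order on `T` can be expanded to a cyclic order on everything by inserting, after each
`x ∈ G ⊆ T`, the new point `f x`. -/
theorem exists_perm_insert [Finite V] (T G : Finset V) (hG : G ⊆ T) (ρ : Equiv.Perm V)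
    (hfix : ∀ x, x ∉ T → ρ x = x) (hρ : ρ.IsCycleOn (T : Set V)) (f : G → V)
    (hf : Function.Injective f) (hfT : ∀ x, f x ∉ T) (hcover : ∀ v, v ∉ T → ∃ x, f x = v)
    (hT : T.Nonempty) :
    ∃ τ : Equiv.Perm V, τ.IsCycleOn Set.univ ∧ (∀ x ∈ T, x ∉ G → τ x = ρ x) ∧
      (∀ x : G, τ x = f x) ∧ ∀ x : G, τ (f x) = ρ x := by
  have hfG : ∀ x, f x ∉ G := fun x hx => hfT x (hG hx)
  let g : V → V := fun v => if h : v ∈ G then f ⟨v, h⟩ else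
    if h : ∃ x, f x = v then (h.choose : V) else v
  have g1 : ∀ x : G, g x = f x := fun x => by simp [g]
  have g2 : ∀ x : G, g (f x) = x := fun x => by
    have hex : ∃ y, f y = f x := ⟨x, rfl⟩
    simp only [g, dif_neg (hfG x), dif_pos hex]
    exact congrArg _ (hf hex.choose_spec)
  have g3 : ∀ x ∈ T, x ∉ G → g x = x := fun x hx hxG => by
    have hex : ¬ ∃ y, f y = x := fun ⟨y, hy⟩ => hfT y (hy ▸ hx)
    simp only [g, dif_neg hxG, dif_neg hex]
  have hg : Function.Involutive g := by
    intro v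
    by_cases hv : v ∈ T
    · by_cases hvG : v ∈ G
      · rw [g1 ⟨v, hvG⟩, g2]
      · rw [g3 v hv hvG, g3 v hv hvG]
    · obtain ⟨x, rfl⟩ := hcover v hv
      rw [g2, g1]
  let τ : Equiv.Perm V := hg.toPerm.trans ρ
  have hτ : ∀ v, τ v = ρ (g v) := fun v => rfl
  have t1 : ∀ x ∈ T, x ∉ G → τ x = ρ x := fun x hx hxG => by rw [hτ, g3 x hx hxG]
  have t2 : ∀ x : G, τ x = f x := fun x => by rw [hτ, g1, hfix _ (hfT x)]
  have t3 : ∀ x : G, τ (f x) = ρ x := fun x => by rw [hτ, g2]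
  refine ⟨τ, ⟨Set.bijOn_univ.2 τ.bijective, ?_⟩, t1, t2, t3⟩
  have step : ∀ x ∈ T, τ.SameCycle x (ρ x) := by
    intro x hx
    by_cases hxG : x ∈ G
    · have h2 := t2 ⟨x, hxG⟩
      have h3 := t3 ⟨x, hxG⟩
      exact ⟨2, by rw [zpow_two, Equiv.Perm.mul_apply]; rw [h2, h3]⟩
    · exact ⟨1, by rw [zpow_one, t1 x hx hxG]⟩
  have hmaps : ∀ x ∈ T, ρ x ∈ T := fun x hx => hρ.1.mapsTo hx
  have hpow : ∀ k : ℕ, ∀ x ∈ T, (ρ ^ k) x ∈ T ∧ τ.SameCycle x ((ρ ^ k) x) := by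
    intro k
    induction k with
    | zero => intro x hx; exact ⟨hx, Equiv.Perm.SameCycle.refl _ _⟩
    | succ k ih =>
      intro x hx
      rw [pow_succ', Equiv.Perm.mul_apply]
      exact ⟨hmaps _ (ih x hx).1, (ih x hx).2.trans (step _ (ih x hx).1)⟩
  obtain ⟨x₀, hx₀⟩ := hT
  have hall : ∀ v, τ.SameCycle x₀ v := by
    have hT' : ∀ v ∈ T, τ.SameCycle x₀ v := by
      intro v hv
      obtain ⟨k, -, hk⟩ := hρ.exists_pow_eq hx₀ hv
      exact hk ▸ (hpow k x₀ hx₀).2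
    intro v
    by_cases hv : v ∈ T
    · exact hT' v hv
    · obtain ⟨x, rfl⟩ := hcover v hv
      exact (hT' x (hG x.2)).trans ⟨1, by rw [zpow_one, t2]⟩
  exact fun x _ y _ => (hall x).symm.trans (hall y)

end Assembly

section Completion

open scoped Classical

theorem exists_isCycleOn_of_forest {V C : Type*} [Fintype V] [Fintype C]
    (hVC : Fintype.card V = Fintype.card C) (D : C → V → V → Prop)
    (A : Finset V) (C' : Finset C) (p M : ℕ)
    (hout : ∀ i ∈ C', ∀ b, b ∉ A → (A.filter fun a => ¬ D i b a).card ≤ p)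
    (hin : ∀ i ∈ C', ∀ b, b ∉ A → (A.filter fun a => ¬ D i a b).card ≤ p)
    (β : Fin M × Bool → V) (hβ : Function.Injective β) (hβA : ∀ x, β x ∉ A)
    (κ : Fin M × Bool → C) (hκ : Function.Injective κ)
    (S : Finset (C × V × V)) (hS : RainbowForest D S)
    (hC : ∀ i, i ∉ C' → i ∈ cols S) (hA : ∀ a ∈ A, a ∈ srcs S ↔ a ∈ tgts S)
    (hW : ∀ a ∈ A, a ∉ srcs S → M ≤ 2 * (univ.filter fun j =>
      D (κ (j, false)) (β (j, false)) a ∧ D (κ (j, true)) a (β (j, true))).card)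
    (hbal : bal A S = A.card - Aᶜ.card) (hM0 : 0 < M) (hM : 4 * p + 6 * S.card ≤ M) :
    ∃ τ : Equiv.Perm V, τ.IsCycleOn Set.univ ∧ ∃ col : V → C, Function.Bijective col ∧
      ∀ v, D (col v) v (τ v) := by
  -- the gadgets that survive
  set J : Finset (Fin M) := univ.filter fun j =>
    (∀ t, β (j, t) ∉ srcs S ∪ tgts S) ∧ ∀ t, κ (j, t) ∉ cols S with hJ
  have hJmem : ∀ j ∈ J, (∀ t, β (j, t) ∉ srcs S ∪ tgts S) ∧ ∀ t, κ (j, t) ∉ cols S :=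
    fun j hj => (mem_filter.1 hj).2
  have hJc : Jᶜ.card ≤ 3 * S.card := by
    have h1 := card_filter_exists_mem_le β hβ (srcs S ∪ tgts S)
    have h2 := card_filter_exists_mem_le κ hκ (cols S)
    have h3 : Jᶜ ⊆ (univ.filter fun j => ∃ t, β (j, t) ∈ srcs S ∪ tgts S) ∪
        (univ.filter fun j => ∃ t, κ (j, t) ∈ cols S) := by
      intro j hj
      simp only [hJ, mem_compl, mem_filter, mem_univ, true_and, not_and_or, not_forall,
        not_not] at hj
      simpa only [mem_union, mem_filter, mem_univ, true_and] using hj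
    have h4 := (card_le_card h3).trans (card_union_le _ _)
    have h5 := card_union_le (srcs S) (tgts S)
    have h6 := card_srcs_le S
    have h7 := card_tgts_le S
    have h8 := card_cols_le S
    omega
  -- the cyclic order of the skeleton
  obtain ⟨S', hS', hSS', hSJ, -⟩ := exists_forest_with_gadgets hS β hβ κ hκ J hJmem
  obtain ⟨key, hkey, hkey'⟩ := hS'.exists_key
  set T : Finset V := Aᶜ ∪ (A ∩ srcs S) with hT
  have hsT : ∀ v, v ∈ srcs S → v ∈ T := fun v hv => by
    by_cases hvA : v ∈ A <;> simp [hT, hvA, hv]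
  have htT : ∀ v, v ∈ tgts S → v ∈ T := fun v hv => by
    by_cases hvA : v ∈ A
    · simp [hT, hvA, (hA v hvA).2 hv]
    · simp [hT, hvA]
  have hBT : ∀ v, v ∉ A → v ∈ T := fun v hv => by simp [hT, hv]
  have hnT : ∀ v, v ∉ T → v ∈ A ∧ v ∉ srcs S := fun v hv => by
    refine ⟨by_contra fun h => hv (hBT v h), fun h => hv (hsT v h)⟩
  obtain ⟨ρ, hρfix, hρ, hρkey⟩ := exists_perm_of_key T key hkey
  have hρS : ∀ e ∈ S, ρ e.2.1 = e.2.2 := fun e he =>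
    hρkey _ (hsT _ (mem_srcs.2 ⟨e.1, e.2.2, he⟩)) _ (htT _ (mem_tgts.2 ⟨e.1, e.2.1, he⟩))
      (hkey' e (hSS' he)).1 (hkey' e (hSS' he)).2
  have hρJ : ∀ j ∈ J, ρ (β (j, false)) = β (j, true) := fun j hj =>
    hρkey _ (hBT _ (hβA _)) _ (hBT _ (hβA _)) (hkey' _ (hSJ j hj)).1 (hkey' _ (hSJ j hj)).2
  -- the gaps
  set G : Finset V := T \ srcs S with hG
  have hGT : G ⊆ T := sdiff_subset
  have hGA : ∀ x ∈ G, x ∉ A := by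
    intro x hx hxA
    simp only [hG, hT, mem_sdiff, mem_union, mem_compl, mem_inter] at hx
    tauto
  have hGs : ∀ x ∈ G, x ∉ srcs S := fun x hx => (mem_sdiff.1 hx).2
  have hρA : ∀ x ∈ G, ρ x ∉ A := by
    intro x hx hxA
    have h1 : ρ x ∈ T := hρ.1.mapsTo (hGT hx)
    have h2 : ρ x ∈ srcs S := by
      simp only [hT, mem_union, mem_compl, mem_inter] at h1
      tauto
    obtain ⟨i, u, he⟩ := mem_tgts.1 ((hA _ hxA).1 h2)
    have h3 : u = x := ρ.injective (hρS _ he)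
    exact hGs x hx (mem_srcs.2 ⟨i, _, h3 ▸ he⟩)
  have hJG : ∀ j ∈ J, β (j, false) ∈ G := fun j hj =>
    mem_sdiff.2 ⟨hBT _ (hβA _), fun h => (hJmem j hj).1 false (mem_union_left _ h)⟩
  -- counting
  have hbal' := hS.bal_eq A
  have hAst : A ∩ tgts S = A ∩ srcs S := by
    ext a; simp only [mem_inter]
    exact ⟨fun h => ⟨h.1, (hA a h.1).2 h.2⟩, fun h => ⟨h.1, (hA a h.1).1 h.2⟩⟩
  rw [hAst, hbal] at hbal'
  have hTcard : T.card = Aᶜ.card + (A ∩ srcs S).card := card_union_of_disjoint (by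
    rw [disjoint_left]; intro a h1 h2; exact (mem_compl.1 h1) (mem_inter.1 h2).1)
  have hGcard : G.card + S.card = T.card := by
    rw [hG, ← hS.card_srcs]; exact card_sdiff_add_card_eq_card fun v hv => hsT v hv
  have hTc : T.card + Tᶜ.card = Fintype.card C := by rw [card_add_card_compl, hVC]
  have hAc : A.card + Aᶜ.card = Fintype.card C := by rw [card_add_card_compl, hVC]
  have hGR : G.card = Tᶜ.card := by omega
  have hUc : (cols S).card + (cols S)ᶜ.card = Fintype.card C :=
    card_add_card_compl _
  rw [hS.card_cols] at hUc
  -- the colours of the gaps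
  have hUcard : Fintype.card (G × Bool) = (cols S)ᶜ.card := by
    simp only [Fintype.card_prod, Fintype.card_coe, Fintype.card_bool]
    omega
  have : Nonempty (Fin M) := ⟨⟨0, hM0⟩⟩
  have hβ0 : Function.Injective fun j => β (j, false) := fun a b hab => by
    simpa using hβ hab
  obtain ⟨ψ, hψ⟩ := Finset.exists_equiv_extend_of_card_eq hUcard
    (s := univ.filter fun x => ∃ j ∈ J, β (j, false) = x.1)
    (f := fun x => κ (Function.invFun (fun j => β (j, false)) x.1, x.2)) (by
      intro i hi
      simp only [mem_image, mem_filter, mem_univ, true_and] at hi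
      obtain ⟨⟨x, t⟩, ⟨j, hj, hjx⟩, rfl⟩ := hi
      simp only at hjx ⊢
      rw [← hjx, Function.leftInverse_invFun hβ0 j, mem_compl]
      exact (hJmem j hj).2 t) (by
      rintro ⟨x, t⟩ hx ⟨x', t'⟩ hx' heq
      simp only [coe_filter, mem_univ, true_and, Set.mem_ofPred_eq] at hx hx'
      obtain ⟨j, hj, hjx⟩ := hx
      obtain ⟨j', hj', hjx'⟩ := hx'
      simp only [← hjx, ← hjx'] at heq
      rw [Function.leftInverse_invFun hβ0 j, Function.leftInverse_invFun hβ0 j'] at heq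
      have := hκ heq
      simp only [Prod.mk.injEq] at this
      refine Prod.ext (Subtype.ext ?_) this.2
      rw [← hjx, ← hjx', this.1])
  have hψJ : ∀ j (hj : j ∈ J) t, (ψ (⟨β (j, false), hJG j hj⟩, t) : C) = κ (j, t) := by
    intro j hj t
    rw [hψ _ (by simp only [mem_filter, mem_univ, true_and]; exact ⟨j, hj, rfl⟩)]
    simp only
    rw [Function.leftInverse_invFun hβ0 j]
  have hψC : ∀ x, (ψ x : C) ∈ C' := fun x => by
    by_contra h
    exact (mem_compl.1 (ψ x).2) (hC _ h)
  -- colouring the remaining edges by the Hall marriage theorem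
  let N : G → Finset V := fun x => Tᶜ.filter fun a =>
    D (ψ (x, false)) x a ∧ D (ψ (x, true)) a (ρ x)
  have hN : ∀ x, Tᶜ.card ≤ (N x).card + 2 * p := by
    intro x
    have h1 := hout _ (hψC (x, false)) x (hGA x x.2)
    have h2 := hin _ (hψC (x, true)) (ρ x) (hρA x x.2)
    have h3 : Tᶜ ⊆ N x ∪ ((A.filter fun a => ¬ D (ψ (x, false)) x a) ∪
        (A.filter fun a => ¬ D (ψ (x, true)) a (ρ x))) := by
      intro a ha
      have haA := (hnT a (mem_compl.1 ha)).1
      simp only [N, mem_union, mem_filter, ha, haA, true_and]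
      tauto
    have h4 := (card_le_card h3).trans (card_union_le _ _)
    have h5 := card_union_le (A.filter fun a => ¬ D (ψ (x, false)) x a)
      (A.filter fun a => ¬ D (ψ (x, true)) a (ρ x))
    omega
  have hN' : ∀ a ∈ Tᶜ, 2 * p ≤ (univ.filter fun x : G => a ∈ N x).card := by
    intro a ha
    have haA := hnT a (mem_compl.1 ha)
    have h1 := hW a haA.1 haA.2
    set X := univ.filter fun j =>
      D (κ (j, false)) (β (j, false)) a ∧ D (κ (j, true)) a (β (j, true)) with hX
    have h2 : X.card ≤ (X ∩ J).card + Jᶜ.card := by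
      refine (card_le_card (t := X ∩ J ∪ Jᶜ) ?_).trans (card_union_le _ _)
      intro j hj
      by_cases hjJ : j ∈ J <;> simp [hj, hjJ]
    have h3 : (X ∩ J).card ≤ (univ.filter fun x : G => a ∈ N x).card := by
      have h4 : (X ∩ J).card = ((X ∩ J).attach.image fun j : {x // x ∈ X ∩ J} =>
          (⟨β (j, false), hJG j (mem_inter.1 j.2).2⟩ : G)).card := by
        rw [card_image_of_injective _ fun j j' hjj' => Subtype.ext (hβ0 (Subtype.ext_iff.1 hjj')),
          card_attach]
      rw [h4]
      refine card_le_card fun x hx => ?_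
      obtain ⟨⟨j, hj⟩, -, rfl⟩ := mem_image.1 hx
      have hjX := (mem_filter.1 (mem_inter.1 hj).1).2
      have hjJ := (mem_inter.1 hj).2
      simp only [mem_filter, mem_univ, true_and, N, ha]
      rw [hψJ j hjJ, hψJ j hjJ, hρJ j hjJ]
      exact hjX
    omega
  obtain ⟨f, hf, hfN⟩ := (Finset.all_card_le_biUnion_card_iff_exists_injective N).1 (by
    intro s
    rcases s.eq_empty_or_nonempty with rfl | ⟨x, hx⟩
    · simp
    have h1 : (N x).card ≤ (s.biUnion N).card := card_le_card (subset_biUnion_of_mem N hx)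
    have h2 := hN x
    by_cases hs : s.card + 2 * p ≤ Tᶜ.card
    · omega
    · have h3 : Tᶜ ⊆ s.biUnion N := by
        intro a ha
        by_contra hcon
        have h4 : (univ.filter fun x : G => a ∈ N x) ⊆ sᶜ := by
          intro y hy
          rw [mem_compl]
          intro hys
          exact hcon (mem_biUnion.2 ⟨y, hys, (mem_filter.1 hy).2⟩)
        have h5 := card_le_card h4
        have h6 := hN' a ha
        have h7 : s.card + sᶜ.card = G.card := by
          rw [card_add_card_compl, Fintype.card_coe]
        omega
      have h8 := card_le_card h3
      have h9 : s.card ≤ G.card := by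
        have := card_le_univ s
        rwa [Fintype.card_coe] at this
      omega)
  have hfT : ∀ x, f x ∉ T := fun x => mem_compl.1 (mem_filter.1 (hfN x)).1
  have hcover : ∀ v, v ∉ T → ∃ x, f x = v := by
    have h1 : univ.image f = Tᶜ := by
      refine eq_of_subset_of_card_le ?_ ?_
      · intro v hv
        obtain ⟨x, -, rfl⟩ := mem_image.1 hv
        exact mem_compl.2 (hfT x)
      · rw [card_image_of_injective _ hf, card_univ, Fintype.card_coe, hGR]
    intro v hv
    have := h1.symm ▸ (mem_compl.2 hv)
    obtain ⟨x, -, hx⟩ := mem_image.1 this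
    exact ⟨x, hx⟩
  have hTne : T.Nonempty := ⟨_, hBT _ (hβA (⟨0, hM0⟩, true))⟩
  obtain ⟨τ, hτ, τ1, τ2, τ3⟩ := exists_perm_insert T G hGT ρ hρfix hρ f hf hfT hcover hTne
  -- the colouring
  have hfs : ∀ x, f x ∉ srcs S := fun x => (hnT _ (hfT x)).2
  let col : V → C := fun v =>
    if h : v ∈ srcs S then (mem_srcs.1 h).choose else
      if h : v ∈ G then ψ (⟨v, h⟩, false) else
        if h : ∃ x, f x = v then ψ (h.choose, true) else κ (⟨0, hM0⟩, true)
  have c1 : ∀ e ∈ S, col e.2.1 = e.1 := by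
    intro e he
    have h : e.2.1 ∈ srcs S := mem_srcs.2 ⟨_, _, he⟩
    simp only [col, dif_pos h]
    obtain ⟨v, hv⟩ := (mem_srcs.1 h).choose_spec
    have := hS.inj_src hv he rfl
    exact congrArg Prod.fst this
  have c2 : ∀ x : G, col x = ψ (x, false) := fun x => by
    simp only [col, dif_neg (hGs x x.2), dif_pos x.2]
  have c3 : ∀ x : G, col (f x) = ψ (x, true) := fun x => by
    have h1 : f x ∉ G := fun h => hfT x (hGT h)
    have hex : ∃ y, f y = f x := ⟨x, rfl⟩
    simp only [col, dif_neg (hfs x), dif_neg h1, dif_pos hex]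
    rw [hf hex.choose_spec]
  refine ⟨τ, hτ, col, (Fintype.bijective_iff_surjective_and_card col).2 ⟨?_, hVC⟩, ?_⟩
  · intro i
    by_cases hi : i ∈ cols S
    · obtain ⟨u, v, he⟩ := mem_cols.1 hi
      exact ⟨u, c1 _ he⟩
    · obtain ⟨⟨x, t⟩, hx⟩ := ψ.surjective ⟨i, mem_compl.2 hi⟩
      cases t
      · exact ⟨x, by rw [c2, hx]⟩
      · exact ⟨f x, by rw [c3, hx]⟩
  · intro v
    by_cases hvT : v ∈ T
    · by_cases hvs : v ∈ srcs S
      · obtain ⟨i, w, he⟩ := mem_srcs.1 hvs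
        have h1 := c1 _ he
        have h2 := hρS _ he
        simp only at h1 h2
        rw [τ1 v hvT fun h => hGs v h hvs, h1, h2]
        exact hS.valid _ he
      · have hvG : v ∈ G := mem_sdiff.2 ⟨hvT, hvs⟩
        have h1 := c2 ⟨v, hvG⟩
        have h2 := τ2 ⟨v, hvG⟩
        simp only at h1 h2
        rw [h1, h2]
        exact (mem_filter.1 (hfN ⟨v, hvG⟩)).2.1
    · obtain ⟨x, rfl⟩ := hcover v hvT
      rw [c3, τ3]
      exact (mem_filter.1 (hfN x)).2.2

end Completion

section Extension

open scoped Classical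

theorem exists_pair_avoid {α β : Type*} [Fintype α] [Fintype β] (P : Finset (α × β))
    (T : Finset α) (U : Finset β)
    (h : T.card * Fintype.card β + Fintype.card α * U.card < P.card) :
    ∃ e ∈ P, e.1 ∉ T ∧ e.2 ∉ U := by
  by_contra! hcon
  have h1 : P ⊆ T ×ˢ univ ∪ univ ×ˢ U := by
    intro e he
    by_cases h : e.1 ∈ T
    · simp [h]
    · simp [hcon e he h]
  have h2 := (card_le_card h1).trans (card_union_le _ _)
  rw [card_product, card_product, card_univ, card_univ] at h2
  omega

variable {V C : Type*} [Fintype V] {n : ℕ} {D : C → V → V → Prop}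

theorem exists_extend_srcs [Fintype C] (hV : Fintype.card V = n) (hC : Fintype.card C = n)
    (A R Z : Finset V) (C' : Finset C) (w : ℤ) {S₀ : Finset (C × V × V)}
    (hS : RainbowForest D S₀) (hSZ : srcs S₀ ⊆ Z) (X : Finset V) (hXZ : X ⊆ Z)
    (hX : ∀ x ∈ X, x ∉ srcs S₀)
    (hw : ∀ x ∈ X, ∀ y ∈ R, ((if x ∈ A then 1 else 0) + (if y ∈ A then 1 else 0) - 1 : ℤ) = w)
    (hcount : ∀ x ∈ X, n * (2 * (S₀.card + X.card) + Z.card) <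
      ((C' ×ˢ R).filter fun e => D e.1 x e.2).card) :
    ∃ S, S₀ ⊆ S ∧ RainbowForest D S ∧ S.card = S₀.card + X.card ∧ srcs S = srcs S₀ ∪ X ∧
      tgts S ⊆ tgts S₀ ∪ (R \ Z) ∧ bal A S = bal A S₀ + X.card * w := by
  induction X using Finset.induction_on with
  | empty => exact ⟨S₀, Subset.rfl, hS, by simp, by simp, subset_union_left, by simp⟩
  | insert x X hx ih =>
    rw [card_insert_of_notMem hx] at hcount
    obtain ⟨S, h1, h2, h3, h4, h5, h6⟩ := ih ((subset_insert _ _).trans hXZ)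
      (fun x hx => hX x (mem_insert_of_mem hx)) (fun x hx => hw x (mem_insert_of_mem hx))
      (fun x hx => lt_of_le_of_lt (Nat.mul_le_mul_left _ (by omega))
        (hcount x (mem_insert_of_mem hx)))
    obtain ⟨⟨i, y⟩, he, hi, hy⟩ := exists_pair_avoid _ (cols S) (Z ∪ tgts S) (by
      refine lt_of_le_of_lt ?_ (hcount x (mem_insert_self _ _))
      have h7 := card_cols_le S
      have h8 := card_tgts_le S
      have h9 := card_union_le Z (tgts S)
      rw [hV, hC, mul_comm, ← mul_add]
      exact Nat.mul_le_mul_left _ (by omega))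
    simp only [mem_filter, mem_product, mem_union, not_or] at he hi hy
    have hxs : x ∉ srcs S := by
      rw [h4, mem_union, not_or]
      exact ⟨hX x (mem_insert_self _ _), hx⟩
    have hxZ : x ∈ Z := hXZ (mem_insert_self _ _)
    have hsZ : srcs S ⊆ Z := h4 ▸ union_subset hSZ ((subset_insert _ _).trans hXZ)
    refine ⟨insert (i, x, y) S, h1.trans (subset_insert _ _),
      h2.insert_of_fresh_head he.2 hi hxs hy.2 (fun h => hy.1 (h ▸ hxZ))
        (fun h => hy.1 (hsZ h)), ?_, ?_, ?_, ?_⟩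
    · rw [card_insert' hi, h3, card_insert_of_notMem hx]; ring
    · rw [srcs_insert, h4, union_insert]
    · rw [tgts_insert]
      refine insert_subset ?_ h5
      exact mem_union_right _ (mem_sdiff.2 ⟨he.1.2, hy.1⟩)
    · rw [bal_insert A hi, h6, hw x (mem_insert_self _ _) y he.1.2, card_insert_of_notMem hx]
      push_cast; ring

theorem exists_extend_tgts [Fintype C] (hV : Fintype.card V = n) (hC : Fintype.card C = n)
    (A R Z : Finset V) (C' : Finset C) (w : ℤ) {S₀ : Finset (C × V × V)}
    (hS : RainbowForest D S₀) (hSZ : tgts S₀ ⊆ Z) (X : Finset V) (hXZ : X ⊆ Z)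
    (hX : ∀ x ∈ X, x ∉ tgts S₀)
    (hw : ∀ x ∈ X, ∀ y ∈ R, ((if x ∈ A then 1 else 0) + (if y ∈ A then 1 else 0) - 1 : ℤ) = w)
    (hcount : ∀ x ∈ X, n * (2 * (S₀.card + X.card) + Z.card) <
      ((C' ×ˢ R).filter fun e => D e.1 e.2 x).card) :
    ∃ S, S₀ ⊆ S ∧ RainbowForest D S ∧ S.card = S₀.card + X.card ∧ tgts S = tgts S₀ ∪ X ∧
      srcs S ⊆ srcs S₀ ∪ (R \ Z) ∧ bal A S = bal A S₀ + X.card * w := by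
  obtain ⟨S, h1, h2, h3, h4, h5, h6⟩ := exists_extend_srcs hV hC A R Z C' w hS.rev
    (by rwa [srcs_rev]) X hXZ (by rwa [srcs_rev]) hw (by rwa [card_rev])
  refine ⟨rev S, ?_, h2.rev, ?_, ?_, ?_, ?_⟩
  · have := rev_mono h1
    rwa [rev_rev] at this
  · rw [card_rev, h3, card_rev]
  · rw [tgts_rev, h4, srcs_rev]
  · rw [srcs_rev]; rwa [tgts_rev] at h5
  · rw [bal_rev, h6, bal_rev]

theorem exists_extend_cols (hV : Fintype.card V = n) (hloop : ∀ i v, ¬ D i v v)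
    (A Z : Finset V) (w : C → ℤ) {S₀ : Finset (C × V × V)}
    (hS : RainbowForest D S₀) (J : Finset C) (hJ : ∀ i ∈ J, i ∉ cols S₀)
    (hcount : ∀ i ∈ J, 2 * n * (2 * (S₀.card + J.card) + Z.card) <
      ((univ : Finset (V × V)).filter fun e => D i e.1 e.2 ∧
        ((if e.1 ∈ A then 1 else 0) + (if e.2 ∈ A then 1 else 0) - 1 : ℤ) = w i).card) :
    ∃ S, S₀ ⊆ S ∧ RainbowForest D S ∧ S.card = S₀.card + J.card ∧ cols S = cols S₀ ∪ J ∧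
      srcs S ⊆ srcs S₀ ∪ Zᶜ ∧ tgts S ⊆ tgts S₀ ∪ Zᶜ ∧
      bal A S = bal A S₀ + ∑ i ∈ J, w i := by
  induction J using Finset.induction_on with
  | empty => exact ⟨S₀, Subset.rfl, hS, by simp, by simp, subset_union_left, subset_union_left,
      by simp⟩
  | insert i J hi ih =>
    rw [card_insert_of_notMem hi] at hcount
    obtain ⟨S, h1, h2, h3, h4, h5, h5', h6⟩ := ih
      (fun x hx => hJ x (mem_insert_of_mem hx))
      (fun x hx => lt_of_le_of_lt (Nat.mul_le_mul_left _ (by omega))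
        (hcount x (mem_insert_of_mem hx)))
    obtain ⟨⟨u, v⟩, he, hu, hv⟩ := exists_pair_avoid _ (Z ∪ (srcs S ∪ tgts S))
      (Z ∪ (srcs S ∪ tgts S)) (by
      refine lt_of_le_of_lt ?_ (hcount i (mem_insert_self _ _))
      have h7 := card_srcs_le S
      have h8 := card_tgts_le S
      have h9 := card_union_le Z (srcs S ∪ tgts S)
      have h10 := card_union_le (srcs S) (tgts S)
      rw [hV, mul_comm, ← two_mul, mul_assoc]
      exact Nat.mul_le_mul_left _ (Nat.mul_le_mul_left _ (by omega)))
    simp only [mem_filter, mem_univ, true_and, mem_union, not_or] at he hu hv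
    have his : i ∉ cols S := by
      rw [h4, mem_union, not_or]
      exact ⟨hJ i (mem_insert_self _ _), hi⟩
    refine ⟨insert (i, u, v) S, h1.trans (subset_insert _ _),
      h2.insert_of_fresh_head he.1 his hu.2.1 hv.2.2 (fun h => hloop i u (by
        have := he.1; rwa [← h] at this)) hv.2.1, ?_, ?_, ?_, ?_, ?_⟩
    · rw [card_insert' his, h3, card_insert_of_notMem hi]; ring
    · rw [cols_insert, h4, union_insert]
    · rw [srcs_insert]
      exact insert_subset (mem_union_right _ (mem_compl.2 hu.1)) h5
    · rw [tgts_insert]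
      exact insert_subset (mem_union_right _ (mem_compl.2 hv.1)) h5'
    · rw [bal_insert A his, h6, he.2, sum_insert hi]
      ring

theorem exists_extend_reduce (A X : Finset V) (hXA : X ⊆ A) (C' : Finset C) (p t : ℕ) (hpt : p ≤ t)
    (hin : ∀ i ∈ C', ∀ b, b ∉ A → (A.filter fun a => ¬ D i a b).card ≤ p)
    {S₀ : Finset (C × V × V)} (hS : RainbowForest D S₀) (r : ℕ)
    (hr : r + t ≤ (X \ srcs S₀).card) (hC' : S₀.card + r ≤ C'.card)
    (hB : 2 * (S₀.card + r) ≤ Aᶜ.card) :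
    ∃ S, S₀ ⊆ S ∧ RainbowForest D S ∧ S.card = S₀.card + r ∧ srcs S ⊆ srcs S₀ ∪ X ∧
      tgts S ⊆ tgts S₀ ∪ Aᶜ ∧ (X \ srcs S).card + r = (X \ srcs S₀).card ∧
      bal A S = bal A S₀ := by
  induction r with
  | zero => exact ⟨S₀, Subset.rfl, hS, by simp, subset_union_left, subset_union_left, rfl, rfl⟩
  | succ r ih =>
    obtain ⟨S, h1, h2, h3, h4, h5, h6, h7⟩ := ih (by omega) (by omega) (by omega)
    obtain ⟨i, hi, his⟩ : ∃ i ∈ C', i ∉ cols S := exists_mem_notMem_of_card_lt_card (by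
      have := card_cols_le S
      omega)
    obtain ⟨b, hb, hbs⟩ : ∃ b ∈ Aᶜ, b ∉ srcs S ∪ tgts S := exists_mem_notMem_of_card_lt_card (by
      have := card_srcs_le S
      have := card_tgts_le S
      have := card_union_le (srcs S) (tgts S)
      omega)
    rw [mem_compl] at hb
    rw [mem_union, not_or] at hbs
    obtain ⟨x, hx, hxb⟩ : ∃ x ∈ X \ srcs S, x ∉ A.filter fun a => ¬ D i a b :=
      exists_mem_notMem_of_card_lt_card (by
        have := hin i hi b hb
        omega)
    rw [mem_sdiff] at hx
    have hxA := hXA hx.1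
    have hD : D i x b := by
      by_contra h
      exact hxb (mem_filter.2 ⟨hxA, h⟩)
    refine ⟨insert (i, x, b) S, h1.trans (subset_insert _ _),
      h2.insert_of_fresh_head hD his hx.2 hbs.2 (fun h => hb (h ▸ hxA)) hbs.1, ?_, ?_, ?_, ?_, ?_⟩
    · rw [card_insert' his, h3]; ring
    · rw [srcs_insert]
      exact insert_subset (mem_union_right _ hx.1) h4
    · rw [tgts_insert]
      exact insert_subset (mem_union_right _ (mem_compl.2 hb)) h5
    · have : X \ srcs (insert (i, x, b) S) = (X \ srcs S).erase x := by
        rw [srcs_insert]; ext z; simp only [mem_sdiff, mem_insert, mem_erase]; tauto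
      have hx' : x ∈ X \ srcs S := mem_sdiff.2 hx
      rw [this, ← h6, ← card_erase_add_one hx']
      ring
    · rw [bal_insert A his, h7, if_pos hxA, if_neg hb]; ring

end Extension

section Extremal

open scoped Classical

variable {V C : Type*} [Fintype V] [Fintype C]

/-- The extremal configuration: `n` digraphs on `n` vertices of minimum semi-degree at least
`⌈n/2⌉`, where `A` has `⌈n/2⌉ + p` vertices and no edge coloured from `C'` lies inside `Aᶜ`. -/
structure IsExtremal (D : C → V → V → Prop) (A : Finset V) (C' : Finset C) (n p q : ℕ) :
    Prop where
  card_vert : Fintype.card V = n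
  card_col : Fintype.card C = n
  loopless : ∀ i v, ¬ D i v v
  le_out : ∀ i v, (n + 1) / 2 ≤ (univ.filter fun w => D i v w).card
  le_in : ∀ i v, (n + 1) / 2 ≤ (univ.filter fun w => D i w v).card
  card_A : A.card = (n + 1) / 2 + p
  card_compl_le : C'ᶜ.card ≤ q
  no_edge : ∀ i ∈ C', ∀ u, u ∉ A → ∀ v, v ∉ A → ¬ D i u v
  p_le : p ≤ 3 * q
  q_pos : 0 < q
  le_n : 1000000 * q ≤ n

variable {D : C → V → V → Prop} {A : Finset V} {C' : Finset C} {n p q : ℕ}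

namespace IsExtremal

theorem rev (h : IsExtremal D A C' n p q) : IsExtremal (fun i u v => D i v u) A C' n p q :=
  ⟨h.card_vert, h.card_col, h.loopless, h.le_in, h.le_out, h.card_A, h.card_compl_le,
    fun i hi u hu v hv => h.no_edge i hi v hv u hu, h.p_le, h.q_pos, h.le_n⟩

theorem card_A_add (h : IsExtremal D A C' n p q) : A.card + Aᶜ.card = n := by
  rw [card_add_card_compl, h.card_vert]

theorem card_C'_add (h : IsExtremal D A C' n p q) : C'.card + C'ᶜ.card = n := by
  rw [card_add_card_compl, h.card_col]

theorem card_filter_add (s : Finset V) (P : V → Prop) :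
    (s.filter P).card + (sᶜ.filter P).card = (univ.filter P).card := by
  rw [← card_union_of_disjoint, ← filter_union, union_compl]
  exact disjoint_filter_filter disjoint_compl_right

theorem card_not_in_le (h : IsExtremal D A C' n p q) {i : C} (hi : i ∈ C') {b : V} (hb : b ∉ A) :
    (A.filter fun a => ¬ D i a b).card ≤ p := by
  have h1 := h.le_in i b
  have h2 := card_filter_add A fun a => D i a b
  have h3 := card_filter_add_card_filter_not (s := A) (fun a => D i a b)
  have h4 : (Aᶜ.filter fun a => D i a b) = ∅ :=
    filter_eq_empty_iff.2 fun u hu => h.no_edge i hi u (mem_compl.1 hu) b hb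
  rw [h4, card_empty] at h2
  have h5 := h.card_A
  omega

theorem card_not_out_le (h : IsExtremal D A C' n p q) {i : C} (hi : i ∈ C') {b : V} (hb : b ∉ A) :
    (A.filter fun a => ¬ D i b a).card ≤ p :=
  h.rev.card_not_in_le hi hb

theorem le_card_in (h : IsExtremal D A C' n p q) (i : C) (v : V) :
    2 * ((n + 1) / 2) + p ≤ n + (A.filter fun a => D i a v).card := by
  have h1 := h.le_in i v
  have h2 := card_filter_add A fun a => D i a v
  have h3 := card_filter_le Aᶜ fun a => D i a v
  have h4 := h.card_A_add
  have h5 := h.card_A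
  omega

theorem lt_card_in (h : IsExtremal D A C' n p q) (i : C) {v : V} (hv : v ∉ A) :
    2 * ((n + 1) / 2) + p < n + (A.filter fun a => D i a v).card := by
  have h1 := h.le_in i v
  have h2 := card_filter_add A fun a => D i a v
  have h3 : (Aᶜ.filter fun a => D i a v).card < Aᶜ.card :=
    card_lt_card (filter_ssubset.2 ⟨v, mem_compl.2 hv, h.loopless i v⟩)
  have h4 := h.card_A_add
  have h5 := h.card_A
  omega

theorem card_pairs {α β : Type*} (C' : Finset α) (R : Finset β) (P : α → β → Prop) :
    ((C' ×ˢ R).filter fun e => P e.1 e.2).card = ∑ i ∈ C', (R.filter fun v => P i v).card := by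
  rw [card_filter, sum_product]
  simp_rw [card_filter]

theorem le_pairs (h : IsExtremal D A C' n p q) (x : V)
    (hx : 20 * ((C' ×ˢ Aᶜ).filter fun e => D e.1 x e.2).card < n ^ 2) :
    n ^ 2 ≤ 20 * ((C' ×ˢ A).filter fun e => D e.1 x e.2).card := by
  have h1 : C'.card * ((n + 1) / 2) ≤ ((C' ×ˢ A).filter fun e => D e.1 x e.2).card +
      ((C' ×ˢ Aᶜ).filter fun e => D e.1 x e.2).card := by
    rw [card_pairs C' A fun i v => D i x v, card_pairs C' Aᶜ fun i v => D i x v,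
      ← sum_add_distrib]
    rw [← smul_eq_mul]
    refine card_nsmul_le_sum _ _ _ fun i _ => ?_
    rw [card_filter_add]
    exact h.le_out i x
  have h2 := h.card_C'_add
  have h3 := h.card_compl_le
  have h4 := h.le_n
  have h5 : n ≤ 2 * ((n + 1) / 2) := by omega
  have h6 : 9 * n ≤ 10 * C'.card := by omega
  have h7 : (9 * n) * n ≤ (10 * C'.card) * (2 * ((n + 1) / 2)) := Nat.mul_le_mul h6 h5
  nlinarith

theorem card_poor_le (h : IsExtremal D A C' n p q) :
    (A.filter fun x => 20 * ((C' ×ˢ Aᶜ).filter fun e => D e.1 x e.2).card < n ^ 2).card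
      ≤ 2 * p := by
  set X := A.filter fun x => 20 * ((C' ×ˢ Aᶜ).filter fun e => D e.1 x e.2).card < n ^ 2 with hX
  set N := C'.card * Aᶜ.card with hN
  have h2 := h.card_C'_add
  have h3 := h.card_compl_le
  have h4 := h.le_n
  have h5 := h.card_A_add
  have h6 := h.card_A
  have h7 := h.p_le
  have h8 := h.q_pos
  have hN' : n ^ 2 ≤ 10 * N := by
    have h6 : 9 * n ≤ 10 * C'.card := by omega
    have h7 : n ≤ 3 * Aᶜ.card := by omega
    have h8 : (9 * n) * n ≤ (10 * C'.card) * (3 * Aᶜ.card) := Nat.mul_le_mul h6 h7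
    nlinarith
  have key : X.card * ((N + 1) / 2) ≤ (C' ×ˢ Aᶜ).card * p := by
    refine card_mul_le_card_mul (fun x e => ¬ D e.1 x e.2) (fun x hx => ?_) fun e he => ?_
    · have h9 := (mem_filter.1 hx).2
      have h10 := card_filter_add_card_filter_not (s := C' ×ˢ Aᶜ) (fun e => D e.1 x e.2)
      rw [card_product] at h10
      rw [bipartiteAbove]
      omega
    · rw [mem_product] at he
      refine le_trans (card_le_card ?_) (h.card_not_in_le he.1 (mem_compl.1 he.2))
      exact filter_subset_filter _ (filter_subset _ _)
  rw [card_product, ← hN] at key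
  have hpos : 0 < N := by
    rcases Nat.eq_zero_or_pos N with h0 | h0
    · rw [h0] at hN'
      have : 0 < n := by omega
      nlinarith
    · exact h0
  have h9 : N ≤ 2 * ((N + 1) / 2) := by omega
  by_contra! hcon
  have : 2 * p + 1 ≤ X.card := hcon
  have h10 := Nat.mul_le_mul this h9
  nlinarith

theorem exists_extend_extra (h : IsExtremal D A C' n p q) {S₀ : Finset (C × V × V)}
    (hS : RainbowForest D S₀) (hS₀ : S₀.card ≤ 1) (Y P : Finset V)
    (hY : ∀ u ∈ A, u ∉ Y → 20 * ((C' ×ˢ A).filter fun e => D e.1 u e.2).card < n ^ 2)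
    (hP : P.card ≤ 20 * q) (k : ℕ) (hk : 2 * n + k + 2 * Y.card ≤ 4 * ((n + 1) / 2) + 2 * p)
    (j : ℕ) (hj : j ≤ k) :
    ∃ S, S₀ ⊆ S ∧ RainbowForest D S ∧ S.card = S₀.card + j ∧ cols S ⊆ cols S₀ ∪ C' ∧
      srcs S ⊆ srcs S₀ ∪ (A \ Y) ∧ tgts S ⊆ tgts S₀ ∪ (A \ P) ∧ bal A S = bal A S₀ + j := by
  induction j with
  | zero => exact ⟨S₀, Subset.rfl, hS, by simp, subset_union_left, subset_union_left,
      subset_union_left, by simp⟩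
  | succ j ih =>
    obtain ⟨S, h1, h2, h3, h4, h5, h5', h6⟩ := ih (by omega)
    set U := srcs S ∪ tgts S with hU
    have hUc : U.card ≤ 2 * S.card := by
      have := card_srcs_le S
      have := card_tgts_le S
      have := card_union_le (srcs S) (tgts S)
      rw [hU]
      omega
    obtain ⟨i, hi, his, u, hu, v, hv, huU, hvU, hD⟩ : ∃ i ∈ C', i ∉ cols S ∧ ∃ u ∈ A \ Y,
        ∃ v ∈ A \ P, u ∉ U ∧ v ∉ U ∧ D i u v := by
      by_contra! hcon
      have key : ((C' \ cols S) ×ˢ (A \ (P ∪ U))).card *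
          (2 * ((n + 1) / 2) + p - n - Y.card) ≤ ((A ∩ U) \ Y).card * (n ^ 2 / 20) := by
        refine card_mul_le_card_mul (fun e u => D e.1 u e.2) (fun e he => ?_) fun u hu => ?_
        · simp only [mem_product, mem_sdiff, mem_union, not_or] at he
          have h7 := h.le_card_in e.1 e.2
          have h8 : (A.filter fun a => D e.1 a e.2) ⊆
              (bipartiteAbove (fun e u => D e.1 u e.2) ((A ∩ U) \ Y) e) ∪ Y := by
            intro a ha
            rw [mem_filter] at ha
            by_cases haY : a ∈ Y
            · exact mem_union_right _ haY
            · refine mem_union_left _ (mem_filter.2 ⟨?_, ha.2⟩)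
              refine mem_sdiff.2 ⟨mem_inter.2 ⟨ha.1, ?_⟩, haY⟩
              by_contra haU
              exact hcon e.1 he.1.1 he.1.2 a (mem_sdiff.2 ⟨ha.1, haY⟩) e.2
                (mem_sdiff.2 ⟨he.2.1, he.2.2.1⟩) haU he.2.2.2 ha.2
          have h9 := (card_le_card h8).trans (card_union_le _ _)
          omega
        · simp only [mem_sdiff, mem_inter] at hu
          have h7 := hY u hu.1.1 hu.2
          refine le_trans (card_le_card (t := (C' ×ˢ A).filter fun e => D e.1 u e.2) ?_) (by omega)
          exact filter_subset_filter _ (product_subset_product sdiff_subset sdiff_subset)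
      have e1 := card_cols_le S
      have e2 := le_card_sdiff (cols S) C'
      have e3 := le_card_sdiff (P ∪ U) A
      have e4 := card_union_le P U
      have e5 := h.card_C'_add
      have e6 := h.card_compl_le
      have e7 := h.le_n
      have e8 := h.card_A
      have e9 := h.p_le
      have e10 := h.q_pos
      have e11 : ((A ∩ U) \ Y).card ≤ U.card :=
        card_le_card (sdiff_subset.trans inter_subset_right)
      rw [card_product] at key
      set g := 2 * ((n + 1) / 2) + p - n - Y.card with hg
      have e12 : k ≤ 2 * g := by omega
      have e13 : ((A ∩ U) \ Y).card ≤ 4 * g := by omega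
      have e14 : 9 * n ≤ 10 * (C' \ cols S).card := by omega
      have e15 : 9 * n ≤ 20 * (A \ (P ∪ U)).card := by omega
      have e16 := Nat.mul_le_mul e14 e15
      have e17 := Nat.mul_le_mul e13 (le_refl (n ^ 2 / 20))
      have e18 : 20 * (n ^ 2 / 20) ≤ n ^ 2 := by omega
      have e19 : 0 < g := by omega
      have e20 : (C' \ cols S).card * (A \ (P ∪ U)).card ≤ 4 * (n ^ 2 / 20) := by
        refine Nat.le_of_mul_le_mul_right (c := g) ?_ e19
        calc _ ≤ _ := key
          _ ≤ _ := e17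
          _ = _ := by ring
      have e21 : 0 < n := by omega
      nlinarith
    rw [mem_sdiff] at hu hv
    simp only [hU, mem_union, not_or] at huU hvU
    refine ⟨insert (i, u, v) S, h1.trans (subset_insert _ _),
      h2.insert_of_fresh_head hD his huU.1 hvU.2 (fun e => h.loopless i u (by
        rwa [← e] at hD)) hvU.1, ?_, ?_, ?_, ?_, ?_⟩
    · rw [card_insert' his, h3]; ring
    · rw [cols_insert]
      exact insert_subset (mem_union_right _ hi) h4
    · rw [srcs_insert]
      exact insert_subset (mem_union_right _ (mem_sdiff.2 hu)) h5
    · rw [tgts_insert]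
      exact insert_subset (mem_union_right _ (mem_sdiff.2 hv)) h5'
    · rw [bal_insert A his, h6, if_pos hu.1, if_pos hv.1]
      push_cast; ring

theorem card_edges (P Q : Finset V) (E : V → V → Prop) :
    ((univ : Finset (V × V)).filter fun e => E e.1 e.2 ∧ e.1 ∈ P ∧ e.2 ∈ Q).card =
      ∑ u ∈ P, (Q.filter fun v => E u v).card := by
  rw [← card_pairs P Q E]
  congr 1
  ext e
  simp only [mem_filter, mem_univ, true_and, mem_product]
  tauto

theorem le_edges_of_few_cross (h : IsExtremal D A C' n p q) (i : C)
    (hi : 20 * ((univ : Finset (V × V)).filter fun e => D i e.1 e.2 ∧ e.1 ∈ A ∧ e.2 ∈ Aᶜ).card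
      < n ^ 2) :
    n ^ 2 ≤ 20 * ((univ : Finset (V × V)).filter fun e => D i e.1 e.2 ∧ e.1 ∈ A ∧ e.2 ∈ A).card ∧
    n ^ 2 ≤ 20 * ((univ : Finset (V × V)).filter fun e =>
      D i e.1 e.2 ∧ e.1 ∈ Aᶜ ∧ e.2 ∈ Aᶜ).card := by
  have h2 := h.card_A_add
  have h3 := h.card_A
  have h4 := h.le_n
  have h5 := h.p_le
  have h5' := h.q_pos
  have h6 : n ≤ 2 * ((n + 1) / 2) := by omega
  constructor
  · have h1 : A.card * ((n + 1) / 2) ≤ ∑ u ∈ A, (A.filter fun v => D i u v).card +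
        ∑ u ∈ A, (Aᶜ.filter fun v => D i u v).card := by
      rw [← sum_add_distrib, ← smul_eq_mul]
      refine card_nsmul_le_sum _ _ _ fun u _ => ?_
      rw [card_filter_add]
      exact h.le_out i u
    rw [card_edges] at hi ⊢
    have h7 : n ≤ 2 * A.card := by omega
    have h8 := Nat.mul_le_mul h7 h6
    nlinarith
  · have h1 : Aᶜ.card * ((n + 1) / 2) ≤ ∑ v ∈ Aᶜ, (A.filter fun u => D i u v).card +
        ∑ v ∈ Aᶜ, (Aᶜ.filter fun u => D i u v).card := by
      rw [← sum_add_distrib, ← smul_eq_mul]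
      refine card_nsmul_le_sum _ _ _ fun u _ => ?_
      rw [card_filter_add]
      exact h.le_in i u
    have h9 : ∀ P Q : Finset V, ∑ v ∈ Q, (P.filter fun u => D i u v).card =
        ∑ u ∈ P, (Q.filter fun v => D i u v).card := fun P Q => 
      (sum_card_bipartiteAbove_eq_sum_card_bipartiteBelow (fun u v => D i u v)).symm
    rw [h9, h9] at h1
    rw [card_edges] at hi ⊢
    have h7 : 9 * n ≤ 20 * Aᶜ.card := by omega
    have h8 := Nat.mul_le_mul h7 h6
    nlinarith

end IsExtremal

end Extremal

section Balance

open scoped Classical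

variable {V C : Type*} [Fintype V] [Fintype C]

/-- The vertices of `A` that send few edges coloured from `C'` to `Aᶜ`. -/
noncomputable def poor (D : C → V → V → Prop) (A : Finset V) (C' : Finset C) (n : ℕ) :
    Finset V :=
  A.filter fun x => 20 * ((C' ×ˢ Aᶜ).filter fun e => D e.1 x e.2).card < n ^ 2

/-- The vertices of `A` that send many edges coloured from `C'` to `A`. -/
noncomputable def rich (D : C → V → V → Prop) (A : Finset V) (C' : Finset C) (n : ℕ) :
    Finset V :=
  A.filter fun x => n ^ 2 ≤ 20 * ((C' ×ˢ A).filter fun e => D e.1 x e.2).card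

variable {D : C → V → V → Prop} {A : Finset V} {C' : Finset C} {n p q : ℕ}

namespace IsExtremal

theorem poor_subset_rich (h : IsExtremal D A C' n p q) : poor D A C' n ⊆ rich D A C' n :=
  fun x hx => mem_filter.2 ⟨(mem_filter.1 hx).1, h.le_pairs x (mem_filter.1 hx).2⟩

theorem exists_extend_inside (h : IsExtremal D A C' n p q) {S₀ : Finset (C × V × V)}
    (hS : RainbowForest D S₀) (hS₀ : S₀.card ≤ 1) (Pp Pm : Finset V)
    (hPp : Pp.card ≤ 20 * q) (hPm : Pm.card ≤ 20 * q) (k : ℕ)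
    (hk : k = 0 ∨
      Pp ⊆ rich D A C' n ∧ 2 * n + k + 2 * (rich D A C' n).card ≤ 4 * ((n + 1) / 2) + 2 * p ∨
      Pm ⊆ rich (fun i u v => D i v u) A C' n ∧
        2 * n + k + 2 * (rich (fun i u v => D i v u) A C' n).card ≤ 4 * ((n + 1) / 2) + 2 * p) :
    ∃ S, RainbowForest D S ∧ S.card = S₀.card + k ∧ cols S₀ ⊆ cols S ∧ cols S ⊆ cols S₀ ∪ C' ∧
      srcs S ⊆ srcs S₀ ∪ (A \ Pp) ∧ tgts S ⊆ tgts S₀ ∪ (A \ Pm) ∧ bal A S = bal A S₀ + k := by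
  rcases hk with rfl | ⟨hP, hk⟩ | ⟨hP, hk⟩
  · exact ⟨S₀, hS, by simp, Subset.rfl, subset_union_left, subset_union_left, subset_union_left,
      by simp⟩
  · obtain ⟨S, h1, h2, h3, h4, h5, h6, h7⟩ := h.exists_extend_extra hS hS₀ (rich D A C' n) Pm
      (fun u hu hu' => not_le.1 fun h => hu' (mem_filter.2 ⟨hu, h⟩)) hPm k hk k le_rfl
    exact ⟨S, h2, h3, cols_mono h1, h4,
      h5.trans (union_subset_union_right (sdiff_subset_sdiff Subset.rfl hP)), h6, h7⟩
  · obtain ⟨S, h1, h2, h3, h4, h5, h6, h7⟩ := h.rev.exists_extend_extra hS.rev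
      (by rwa [card_rev]) (rich (fun i u v => D i v u) A C' n) Pp
      (fun u hu hu' => not_le.1 fun h => hu' (mem_filter.2 ⟨hu, h⟩)) hPp k hk k le_rfl
    rw [card_rev] at h3
    rw [cols_rev] at h4
    rw [srcs_rev] at h5
    rw [tgts_rev] at h6
    rw [bal_rev] at h7
    refine ⟨TransversalHamilton.rev S, h2.rev, ?_, ?_, ?_, ?_, ?_, ?_⟩
    · rw [card_rev, h3]
    · rw [cols_rev, ← cols_rev S₀]; exact cols_mono h1
    · rw [cols_rev]; exact h4
    · rw [srcs_rev]; exact h6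
    · rw [tgts_rev]
      exact h5.trans (union_subset_union_right (sdiff_subset_sdiff Subset.rfl hP))
    · rw [bal_rev, h7]

theorem exists_parity_edge (h : IsExtremal D A C' n p q) (J : Finset C) (Q : Finset V)
    (hQ : n + Q.card ≤ 2 * ((n + 1) / 2) + p) :
    ∃ S, RainbowForest D S ∧ S.card ≤ 1 ∧ cols S ⊆ J ∧ Even (J \ cols S).card ∧
      srcs S ⊆ A \ Q ∧ tgts S ⊆ Aᶜ ∧ bal A S = 0 := by
  have hE : RainbowForest D ∅ := RainbowForest.empty D
    ⟨(Fintype.equivFin V).toEmbedding.trans ⟨fun i => ((i : ℕ) : ℚ), fun i j hij => by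
      simpa [Fin.ext_iff] using hij⟩⟩
  rcases Nat.even_or_odd J.card with hJ | hJ
  · exact ⟨∅, hE, by simp, by simp [cols], by simpa [cols] using hJ, by simp [srcs],
      by simp [tgts], by simp [bal]⟩
  have hJne : J.Nonempty := by
    rw [nonempty_iff_ne_empty]
    rintro rfl
    simp at hJ
  obtain ⟨c, hc⟩ := hJne
  obtain ⟨b, hb⟩ : Aᶜ.Nonempty := by
    rw [← card_pos]
    have h1 := h.card_A_add
    have h2 := h.card_A
    have h3 := h.p_le
    have h4 := h.q_pos
    have h5 := h.le_n
    omega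
  rw [mem_compl] at hb
  obtain ⟨a, ha, haQ⟩ : ∃ a ∈ A.filter fun a => D c a b, a ∉ Q :=
    exists_mem_notMem_of_card_lt_card (by
      have := h.lt_card_in c hb
      omega)
  rw [mem_filter] at ha
  have hi : c ∉ cols (∅ : Finset (C × V × V)) := by simp [cols]
  refine ⟨insert (c, a, b) ∅, hE.insert_of_fresh_head ha.2 hi (by simp [srcs]) (by simp [tgts])
    (fun e => hb (e ▸ ha.1)) (by simp [srcs]), ?_, ?_, ?_, ?_, ?_, ?_⟩
  · simp
  · simpa [cols] using hc
  · have : J \ cols (insert (c, a, b) (∅ : Finset (C × V × V))) = J.erase c := by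
      ext z; simp [cols]; tauto
    rw [this, card_erase_of_mem hc]
    exact Nat.Odd.sub_odd hJ odd_one
  · simp [srcs, ha.1, haQ]
  · simp [tgts, hb]
  · rw [bal_insert A hi, if_pos ha.1, if_neg hb]; simp [bal]

theorem exists_absorb_cols (h : IsExtremal D A C' n p q) (Qp Pp Pm : Finset V)
    (hQP : Qp ⊆ Pp) (hQp : n + Qp.card ≤ 2 * ((n + 1) / 2) + p)
    (hPp : Pp.card ≤ 20 * q) (hPm : Pm.card ≤ 20 * q) (k : ℕ) (hkq : k ≤ 8 * q)
    (hk : k = 0 ∨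
      Pp ⊆ rich D A C' n ∧ 2 * n + k + 2 * (rich D A C' n).card ≤ 4 * ((n + 1) / 2) + 2 * p ∨
      Pm ⊆ rich (fun i u v => D i v u) A C' n ∧
        2 * n + k + 2 * (rich (fun i u v => D i v u) A C' n).card ≤ 4 * ((n + 1) / 2) + 2 * p)
    (hPmA : Pm ⊆ A) :
    ∃ S, RainbowForest D S ∧ S.card ≤ 10 * q ∧ C'ᶜ ⊆ cols S ∧ (Pp ∩ srcs S).card ≤ 1 ∧
      (∀ x ∈ Qp, x ∉ srcs S) ∧ (∀ x ∈ Pm, x ∉ tgts S) ∧ bal A S = k := by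
  set cross : C → Prop := fun i =>
    n ^ 2 ≤ 20 * ((univ : Finset (V × V)).filter fun e => D i e.1 e.2 ∧ e.1 ∈ A ∧ e.2 ∈ Aᶜ).card
    with hcross
  obtain ⟨S₁, a1, a2, a3, a4, a5, a6, a7⟩ := h.exists_parity_edge (C'ᶜ.filter fun i => ¬ cross i)
    Qp hQp
  obtain ⟨S₂, b1, b2, b3, b4, b5, b6, b7⟩ := h.exists_extend_inside a1 a2 Pp Pm hPp hPm k hk
  set K := (C'ᶜ.filter fun i => ¬ cross i) \ cols S₁ with hK
  obtain ⟨H, hHK, hH⟩ := exists_subset_card_eq (s := K) (n := K.card / 2) (by omega)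
  set J := C'ᶜ \ cols S₂ with hJ
  have hKJ : K ⊆ J := by
    intro i hi
    simp only [hK, hJ, mem_sdiff, mem_filter] at hi ⊢
    refine ⟨hi.1.1, fun hi' => ?_⟩
    rcases mem_union.1 (b4 hi') with h | h
    · exact hi.2 h
    · exact mem_compl.1 hi.1.1 h
  have hq := h.q_pos
  have hn := h.le_n
  have hJc : J.card ≤ q := (card_le_card sdiff_subset).trans h.card_compl_le
  obtain ⟨S, c1, c2, c3, c4, c5, c6, c7⟩ := exists_extend_cols h.card_vert h.loopless A (Pp ∪ Pm)
    (fun i => (if i ∈ H then 2 else 0) - (if i ∈ K then 1 else 0)) b1 J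
    (fun i hi => (mem_sdiff.1 hi).2) (by
      intro i hi
      have hlarge : ∀ E : Finset (V × V), n ^ 2 ≤ 20 * E.card →
          2 * n * (2 * (S₂.card + J.card) + (Pp ∪ Pm).card) < E.card := by
        intro E hE
        have h1 := card_union_le Pp Pm
        have h2 : 2 * (S₂.card + J.card) + (Pp ∪ Pm).card ≤ 100 * q := by omega
        have h3 := Nat.mul_le_mul (le_refl (2 * n)) h2
        nlinarith
      by_cases hiK : i ∈ K
      · have hic : ¬ cross i := (mem_filter.1 (mem_sdiff.1 hiK).1).2
        have hAB := h.le_edges_of_few_cross i (not_le.1 hic)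
        by_cases hiH : i ∈ H
        · refine lt_of_lt_of_le (hlarge _ hAB.1) (card_le_card fun e he => ?_)
          simp only [mem_filter, mem_univ, true_and] at he ⊢
          simp [he, hiH, hiK]
        · refine lt_of_lt_of_le (hlarge _ hAB.2) (card_le_card fun e he => ?_)
          simp only [mem_filter, mem_univ, true_and, mem_compl] at he ⊢
          simp [he, hiH, hiK]
      · have hiH : i ∉ H := fun h => hiK (hHK h)
        have hic : cross i := by
          by_contra hic
          rw [hJ, mem_sdiff] at hi
          exact hiK (mem_sdiff.2 ⟨mem_filter.2 ⟨hi.1, hic⟩, fun h => hi.2 (b3 h)⟩)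
        refine lt_of_lt_of_le (hlarge _ hic) (card_le_card fun e he => ?_)
        simp only [mem_filter, mem_univ, true_and, mem_compl] at he ⊢
        simp [he, hiH, hiK])
  have hsrc : ∀ x ∈ Pp, x ∈ srcs S → x ∈ srcs S₁ := by
    intro x hx hxs
    rcases mem_union.1 (c5 hxs) with h1 | h1
    · rcases mem_union.1 (b5 h1) with h2 | h2
      · exact h2
      · exact ((mem_sdiff.1 h2).2 hx).elim
    · exact (mem_compl.1 h1 (mem_union_left _ hx)).elim
  refine ⟨S, c2, by omega, ?_, ?_, ?_, ?_, ?_⟩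
  · intro i hi
    rw [c4, mem_union, hJ, mem_sdiff]
    tauto
  · refine (card_le_card (t := srcs S₁) fun x hx => ?_).trans ((card_srcs_le S₁).trans a2)
    exact hsrc x (mem_inter.1 hx).1 (mem_inter.1 hx).2
  · intro x hx hxs
    exact (mem_sdiff.1 (a5 (hsrc x (hQP hx) hxs))).2 hx
  · intro x hx hxs
    rcases mem_union.1 (c6 hxs) with h1 | h1
    · rcases mem_union.1 (b6 h1) with h2 | h2
      · exact mem_compl.1 (a6 h2) (hPmA hx)
      · exact ((mem_sdiff.1 h2).2 hx).elim
    · exact (mem_compl.1 h1 (mem_union_right _ hx)).elim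
  · rw [c7, b7, a7, sum_sub_distrib, sum_ite_mem, sum_ite_mem, inter_eq_right.2 hKJ,
      inter_eq_right.2 (hHK.trans hKJ), sum_const, sum_const, hH]
    obtain ⟨r, hr⟩ := a4
    rw [hr]
    have : (r + r) / 2 = r := by omega
    rw [this]
    simp only [nsmul_eq_mul]
    push_cast
    ring

end IsExtremal

end Balance

section Main

open scoped Classical

theorem exists_core {α : Type*} {X Y : Finset α} (hXY : X ⊆ Y) (t : ℕ) :
    ∃ Q ⊆ Y, Q.card ≤ t ∧ (X ⊆ Q ∧ Q.card = min t Y.card ∨ t < X.card) := by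
  by_cases h : X.card ≤ t
  · obtain ⟨Q, h1, h2, h3⟩ := exists_subsuperset_card_eq hXY
      (le_min h (card_le_card hXY)) (min_le_right t Y.card)
    exact ⟨Q, h2, h3 ▸ min_le_left _ _, Or.inl ⟨h1, h3⟩⟩
  · exact ⟨∅, empty_subset _, by simp, Or.inr (not_le.1 h)⟩

variable {V C : Type*} [Fintype V] [Fintype C] {D : C → V → V → Prop} {A : Finset V}
  {C' : Finset C} {n p q : ℕ}

namespace IsExtremal

theorem exists_reserve_srcs (h : IsExtremal D A C' n p q) (t : ℕ) (hpt : p ≤ t)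
    {S₀ : Finset (C × V × V)} (hS : RainbowForest D S₀) (hS₀ : S₀.card ≤ 20 * q)
    (Q : Finset V) (hQ : Q ⊆ rich D A C' n)
    (hQX : poor D A C' n ⊆ Q ∧ Q.card = min t (rich D A C' n).card ∨ t < (poor D A C' n).card)
    (hQS : ∀ x ∈ Q, x ∉ srcs S₀) (hX : (poor D A C' n ∩ srcs S₀).card ≤ 1) :
    ∃ S, S₀ ⊆ S ∧ RainbowForest D S ∧ S.card ≤ S₀.card + 6 * q ∧ tgts S ⊆ tgts S₀ ∪ Aᶜ ∧
      bal A S = bal A S₀ ∧ ∃ F ⊆ rich D A C' n, F.card = min t (rich D A C' n).card ∧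
        (∀ x ∈ F, x ∉ srcs S) ∧ poor D A C' n ⊆ F ∪ srcs S := by
  rcases hQX with ⟨h1, h2⟩ | h1
  · exact ⟨S₀, Subset.rfl, hS, by omega, subset_union_left, rfl, Q, hQ, h2, hQS,
      h1.trans subset_union_left⟩
  have e1 := card_sdiff_add_card_inter (poor D A C' n) (srcs S₀)
  have e2 := h.card_poor_le
  rw [← poor] at e2
  have e3 := h.p_le
  have e4 := h.card_C'_add
  have e5 := h.card_compl_le
  have e6 := h.le_n
  have e7 := h.q_pos
  have e8 := h.card_A_add
  have e9 := h.card_A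
  obtain ⟨S, a1, a2, a3, a4, a5, a6, a7⟩ := exists_extend_reduce A (poor D A C' n) (filter_subset _ _) C'
    p t hpt (fun i hi b hb => h.card_not_in_le hi hb) hS ((poor D A C' n \ srcs S₀).card - t)
    (by omega) (by omega) (by omega)
  refine ⟨S, a1, a2, by omega, a5, a7, poor D A C' n \ srcs S,
    sdiff_subset.trans h.poor_subset_rich, ?_, fun x hx => (mem_sdiff.1 hx).2, ?_⟩
  · have e10 := card_le_card h.poor_subset_rich
    omega
  · rw [sdiff_union_self_eq_union]; exact subset_union_left

set_option maxHeartbeats 1000000 in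
theorem exists_balanced (h : IsExtremal D A C' n p q) :
    ∃ S, RainbowForest D S ∧ S.card ≤ 29 * q ∧ C'ᶜ ⊆ cols S ∧ bal A S = A.card - Aᶜ.card ∧
      poor D A C' n ⊆ srcs S ∧ poor (fun i u v => D i v u) A C' n ⊆ tgts S := by
  set X := poor D A C' n with hX
  set Y := rich D A C' n with hY
  set X' := poor (fun i u v => D i v u) A C' n with hX'
  set Y' := rich (fun i u v => D i v u) A C' n with hY'
  set m := 2 * ((n + 1) / 2) + p - n with hm
  have e1 : X.card ≤ 2 * p := h.card_poor_le
  have e2 : X'.card ≤ 2 * p := h.rev.card_poor_le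
  have e3 := h.p_le
  have e4 := h.card_C'_add
  have e5 := h.card_compl_le
  have e6 := h.le_n
  have e7 := h.q_pos
  have e8 := h.card_A_add
  have e9 := h.card_A
  have hXY : X ⊆ Y := h.poor_subset_rich
  have hXY' : X' ⊆ Y' := h.rev.poor_subset_rich
  have hYA : Y ⊆ A := (filter_subset _ _)
  have hYA' : Y' ⊆ A := (filter_subset _ _)
  obtain ⟨Q, hQY, hQm, hQ⟩ := exists_core hXY m
  obtain ⟨Q', hQY', hQm', hQ'⟩ := exists_core hXY' p
  have e10 := card_union_le X Q
  have e11 := card_union_le X' Q'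
  obtain ⟨S₁, a1, a2, a3, a4, a5, a6, a7⟩ := h.exists_absorb_cols Q (X ∪ Q) (X' ∪ Q')
    subset_union_right (by omega) (by omega) (by omega)
    (m + p - min m Y.card - min p Y'.card) (by omega) (by
      rcases Nat.eq_zero_or_pos (m + p - min m Y.card - min p Y'.card) with h0 | h0
      · exact Or.inl h0
      · rcases le_total Y.card Y'.card with h1 | h1
        · exact Or.inr (Or.inl ⟨union_subset hXY hQY, by rw [← hY]; omega⟩)
        · exact Or.inr (Or.inr ⟨union_subset hXY' hQY', by rw [← hY']; omega⟩))
    (union_subset (hXY'.trans hYA') (hQY'.trans hYA'))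
  obtain ⟨S₂, b1, b2, b3, b4, b5, F, b6, b7, b8, b9⟩ := h.exists_reserve_srcs m (by omega) a1
    (by omega) Q hQY hQ a5
    ((card_le_card (inter_subset_inter_right subset_union_left)).trans a4)
  have hX'S₂ : ∀ x ∈ X' ∪ Q', x ∉ tgts S₂ := by
    intro x hx hxs
    rcases mem_union.1 (b4 hxs) with h1 | h1
    · exact a6 x hx h1
    · exact mem_compl.1 h1 ((union_subset (hXY'.trans hYA') (hQY'.trans hYA')) hx)
  obtain ⟨S₃, c1, c2, c3, c4, c5, F', c6, c7, c8, c9⟩ := h.rev.exists_reserve_srcs p le_rfl b2.rev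
    (by rw [card_rev]; omega) Q' hQY' hQ'
    (fun x hx => by rw [srcs_rev]; exact hX'S₂ x (mem_union_right _ hx)) (by
      rw [srcs_rev, card_eq_zero.2]
      · omega
      · exact eq_empty_of_forall_notMem fun x hx =>
          hX'S₂ x (mem_union_left _ (mem_inter.1 hx).1) (mem_inter.1 hx).2)
  obtain ⟨S₄, rfl⟩ : ∃ S₄, S₃ = TransversalHamilton.rev S₄ := ⟨_, (rev_rev _).symm⟩
  replace c1 := rev_mono c1
  rw [rev_rev, rev_rev] at c1
  replace c2 := c2.rev
  rw [rev_rev] at c2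
  rw [card_rev, card_rev] at c3
  rw [tgts_rev, tgts_rev] at c4
  rw [bal_rev, bal_rev] at c5
  rw [srcs_rev] at c8 c9
  have hFA : F ⊆ A := b6.trans hYA
  have hFA' : F' ⊆ A := c6.trans hYA'
  have hFS₄ : ∀ x ∈ F, x ∉ srcs S₄ := by
    intro x hx hxs
    rcases mem_union.1 (c4 hxs) with h1 | h1
    · exact b8 x hx h1
    · exact mem_compl.1 h1 (hFA hx)
  have hw : ∀ G : Finset V, G ⊆ A → ∀ x ∈ G, ∀ y ∈ A,
      ((if x ∈ A then 1 else 0) + (if y ∈ A then 1 else 0) - 1 : ℤ) = 1 := by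
    intro G hG x hx y hy
    rw [if_pos (hG hx), if_pos hy]; rfl
  have hn0 : 0 < n := by omega
  have hlarge : ∀ s N : ℕ, s ≤ 1000 * q → n ^ 2 ≤ 20 * N → n * s < N := by
    intro s N hs hN
    nlinarith [Nat.mul_le_mul (le_refl n) hs]
  have f1 := card_srcs_le S₄
  have f2 := card_tgts_le S₄
  have f3 := card_union_le (srcs S₄) (tgts S₄)
  have f4 := card_union_le F F'
  obtain ⟨S₅, d1, d2, d3, d4, d5, d6⟩ := exists_extend_srcs h.card_vert h.card_col A A
    ((srcs S₄ ∪ tgts S₄) ∪ (F ∪ F')) C' 1 c2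
    (subset_union_left.trans subset_union_left) F (subset_union_left.trans subset_union_right)
    hFS₄ (hw F hFA) (fun x hx => by
      have f5 := card_union_le (srcs S₄ ∪ tgts S₄) (F ∪ F')
      exact hlarge _ _ (by omega) (mem_filter.1 (b6 hx)).2)
  have hFS₅ : ∀ x ∈ F', x ∉ tgts S₅ := by
    intro x hx hxs
    rcases mem_union.1 (d5 hxs) with h1 | h1
    · exact c8 x hx h1
    · exact (mem_sdiff.1 h1).2 (mem_union_right _ (mem_union_right _ hx))
  have g1 := card_srcs_le S₅
  have g2 := card_tgts_le S₅
  have g3 := card_union_le (srcs S₅) (tgts S₅)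
  obtain ⟨S₆, i1, i2, i3, i4, i5, i6⟩ := exists_extend_tgts h.card_vert h.card_col A A
    ((srcs S₅ ∪ tgts S₅) ∪ F') C' 1 d2
    (subset_union_right.trans subset_union_left) F' subset_union_right
    hFS₅ (hw F' hFA') (fun x hx => by
      have f5 := card_union_le (srcs S₅ ∪ tgts S₅) F'
      exact hlarge _ _ (by omega) (mem_filter.1 (c6 hx)).2)
  refine ⟨S₆, i2, by omega, ?_, ?_, ?_, ?_⟩
  · exact a3.trans ((cols_mono b1).trans ((cols_mono c1).trans ((cols_mono d1).trans
      (cols_mono i1))))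
  · rw [← hY] at b7
    rw [← hY'] at c7
    rw [i6, d6, c5, b5, a7, b7, c7]
    clear f1 f2 f3 f4 g1 g2 g3 hFS₅ hFS₄ hlarge hw hX'S₂ e10 e11 a2 a4 b3 c3 i3 d3
    have m1 := min_le_left m Y.card
    have m2 := min_le_left p Y'.card
    push_cast [Nat.cast_sub]
    omega
  · have h1 : F ∪ srcs S₂ ⊆ srcs S₅ := by
      rw [d4, union_comm]
      exact union_subset_union_left (srcs_mono c1)
    exact (b9.trans h1).trans (srcs_mono i1)
  · rw [i4, union_comm]
    exact c9.trans (union_subset_union_right (tgts_mono d1))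

theorem card_bad_le (h : IsExtremal D A C' n p q) {M : ℕ} (hM : 0 < M)
    (β : Fin M × Bool → V) (hβA : ∀ x, β x ∉ A) (κ : Fin M × Bool → C) (hκC : ∀ x, κ x ∈ C') :
    (A.filter fun a => 2 * ((univ : Finset (Fin M)).filter fun j =>
      D (κ (j, false)) (β (j, false)) a ∧ D (κ (j, true)) a (β (j, true))).card < M).card
      ≤ 4 * p := by
  set W := A.filter fun a => 2 * ((univ : Finset (Fin M)).filter fun j =>
      D (κ (j, false)) (β (j, false)) a ∧ D (κ (j, true)) a (β (j, true))).card < M with hW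
  have key : W.card * ((M + 1) / 2) ≤ (univ : Finset (Fin M)).card * (2 * p) := by
    refine card_mul_le_card_mul (fun a j =>
      ¬ (D (κ (j, false)) (β (j, false)) a ∧ D (κ (j, true)) a (β (j, true))))
      (fun a ha => ?_) fun j _ => ?_
    · have h1 := (mem_filter.1 ha).2
      have h2 := card_filter_add_card_filter_not (s := (univ : Finset (Fin M)))
        (fun j => D (κ (j, false)) (β (j, false)) a ∧ D (κ (j, true)) a (β (j, true)))
      rw [card_univ, Fintype.card_fin] at h2
      rw [bipartiteAbove]
      omega
    · have h1 := h.card_not_out_le (hκC (j, false)) (hβA (j, false))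
      have h2 := h.card_not_in_le (hκC (j, true)) (hβA (j, true))
      have h3 : bipartiteBelow (fun a j =>
          ¬ (D (κ (j, false)) (β (j, false)) a ∧ D (κ (j, true)) a (β (j, true)))) W j ⊆
          (A.filter fun a => ¬ D (κ (j, false)) (β (j, false)) a) ∪
          (A.filter fun a => ¬ D (κ (j, true)) a (β (j, true))) := by
        intro a ha
        have ha' := mem_filter.1 ha
        have haA := (mem_filter.1 ha'.1).1
        simp only [mem_union, mem_filter, haA, true_and]
        have := ha'.2
        tauto
      have h4 := (card_le_card h3).trans (card_union_le _ _)
      omega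
  rw [card_univ, Fintype.card_fin] at key
  have h9 : M ≤ 2 * ((M + 1) / 2) := by omega
  by_contra! hcon
  have : 4 * p + 1 ≤ W.card := hcon
  have h10 := Nat.mul_le_mul this h9
  nlinarith

theorem exists_isCycleOn (h : IsExtremal D A C' n p q) :
    ∃ τ : Equiv.Perm V, τ.IsCycleOn Set.univ ∧ ∃ col : V → C, Function.Bijective col ∧
      ∀ v, D (col v) v (τ v) := by
  have e3 := h.p_le
  have e4 := h.card_C'_add
  have e5 := h.card_compl_le
  have e6 := h.le_n
  have e7 := h.q_pos
  have e8 := h.card_A_add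
  have e9 := h.card_A
  obtain ⟨S, a1, a2, a3, a4, a5, a6⟩ := h.exists_balanced
  obtain ⟨M, hM⟩ : ∃ M, M = n / 8 := ⟨_, rfl⟩
  obtain ⟨β⟩ : Nonempty (Fin M × Bool ↪ ↥(Aᶜ)) := Function.Embedding.nonempty_of_card_le (by
    simp only [Fintype.card_prod, Fintype.card_fin, Fintype.card_bool, Fintype.card_coe]
    omega)
  obtain ⟨κ⟩ : Nonempty (Fin M × Bool ↪ ↥C') := Function.Embedding.nonempty_of_card_le (by
    simp only [Fintype.card_prod, Fintype.card_fin, Fintype.card_bool, Fintype.card_coe]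
    omega)
  have hβA : ∀ x, (β x : V) ∉ A := fun x => mem_compl.1 (β x).2
  have hWc := h.card_bad_le (by omega) (fun x => (β x : V)) hβA (fun x => (κ x : C))
    fun x => (κ x).2
  set W := A.filter fun a => 2 * ((univ : Finset (Fin M)).filter fun j =>
      D (κ (j, false)) (β (j, false)) a ∧ D (κ (j, true)) a (β (j, true))).card < M with hW
  set L := A ∩ (srcs S ∪ tgts S) ∪ W with hL
  have hLA : L ⊆ A := union_subset inter_subset_left (filter_subset _ _)
  have f1 := card_srcs_le S
  have f2 := card_tgts_le S
  have f3 := card_union_le (srcs S) (tgts S)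
  have f4 : L.card ≤ (srcs S ∪ tgts S).card + W.card :=
    (card_union_le _ _).trans (Nat.add_le_add_right (card_le_card inter_subset_right) _)
  have hw : ∀ G : Finset V, G ⊆ L → ∀ x ∈ G, ∀ y ∈ Aᶜ,
      ((if x ∈ A then 1 else 0) + (if y ∈ A then 1 else 0) - 1 : ℤ) = 0 := by
    intro G hG x hx y hy
    rw [if_pos (hLA (hG hx)), if_neg (mem_compl.1 hy)]; rfl
  have hn0 : 0 < n := by omega
  have hlarge : ∀ s N : ℕ, s ≤ 1000 * q → n ^ 2 ≤ 20 * N → n * s < N := by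
    intro s N hs hN
    nlinarith [Nat.mul_le_mul (le_refl n) hs]
  have g1 : (L \ srcs S).card ≤ L.card := card_le_card sdiff_subset
  obtain ⟨S₁, b1, b2, b3, b4, b5, b6⟩ := exists_extend_srcs h.card_vert h.card_col A Aᶜ
    ((srcs S ∪ tgts S) ∪ L) C' 0 a1 (subset_union_left.trans subset_union_left) (L \ srcs S)
    (sdiff_subset.trans subset_union_right) (fun x hx => (mem_sdiff.1 hx).2) (hw _ sdiff_subset)
    (fun x hx => by
      have f5 := card_union_le (srcs S ∪ tgts S) L
      refine hlarge _ _ (by omega) (not_lt.1 fun hlt => ?_)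
      rw [mem_sdiff] at hx
      exact hx.2 (a5 (mem_filter.2 ⟨hLA hx.1, hlt⟩)))
  have g2 := card_srcs_le S₁
  have g3 := card_tgts_le S₁
  have g4 := card_union_le (srcs S₁) (tgts S₁)
  have g5 : (L \ tgts S₁).card ≤ L.card := card_le_card sdiff_subset
  obtain ⟨S₂, c1, c2, c3, c4, c5, c6⟩ := exists_extend_tgts h.card_vert h.card_col A Aᶜ
    ((srcs S₁ ∪ tgts S₁) ∪ L) C' 0 b2 (subset_union_right.trans subset_union_left) (L \ tgts S₁)
    (sdiff_subset.trans subset_union_right) (fun x hx => (mem_sdiff.1 hx).2) (hw _ sdiff_subset)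
    (fun x hx => by
      have f5 := card_union_le (srcs S₁ ∪ tgts S₁) L
      refine hlarge _ _ (by omega) (not_lt.1 fun hlt => ?_)
      rw [mem_sdiff] at hx
      exact hx.2 (tgts_mono b1 (a6 (mem_filter.2 ⟨hLA hx.1, hlt⟩))))
  have hsrc : ∀ a ∈ A, a ∈ srcs S₂ ↔ a ∈ L := by
    intro a ha
    constructor
    · intro hs
      rcases mem_union.1 (c5 hs) with h1 | h1
      · rw [b4, mem_union, mem_sdiff] at h1
        rcases h1 with h1 | h1
        · exact mem_union_left _ (mem_inter.2 ⟨ha, mem_union_left _ h1⟩)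
        · exact h1.1
      · exact (mem_compl.1 (mem_sdiff.1 h1).1 ha).elim
    · intro haL
      refine srcs_mono c1 ?_
      rw [b4, mem_union, mem_sdiff]
      tauto
  have htgt : ∀ a ∈ A, a ∈ tgts S₂ ↔ a ∈ L := by
    intro a ha
    rw [c4, mem_union, mem_sdiff]
    refine ⟨fun hs => ?_, by tauto⟩
    rcases hs with h1 | h1
    · rcases mem_union.1 (b5 h1) with h1 | h1
      · exact mem_union_left _ (mem_inter.2 ⟨ha, mem_union_right _ h1⟩)
      · exact (mem_compl.1 (mem_sdiff.1 h1).1 ha).elim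
    · exact h1.1
  refine exists_isCycleOn_of_forest (h.card_vert.trans h.card_col.symm) D A C' p M
    (fun i hi b hb => h.card_not_out_le hi hb) (fun i hi b hb => h.card_not_in_le hi hb)
    (fun x => (β x : V)) (Subtype.val_injective.comp β.injective) hβA
    (fun x => (κ x : C)) (Subtype.val_injective.comp κ.injective) S₂ c2 ?_ ?_ ?_ ?_ ?_ ?_
  · exact fun i hi => cols_mono (b1.trans c1) (a3 (mem_compl.2 hi))
  · exact fun a ha => (hsrc a ha).trans (htgt a ha).symm
  · intro a ha has
    rw [hsrc a ha] at has
    by_contra! hcon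
    exact has (mem_union_right _ (mem_filter.2 ⟨ha, hcon⟩))
  · rw [c6, b6, a4]; ring
  · omega
  · omega

end IsExtremal

end Main

end TransversalHamilton

/-- **Extremal-case lemma.**  For `0 < 1/n ≪ δ ≪ 1` and `0 ≤ γ ≤ 3δ`:
let `𝒟 = {D i : i ∈ 𝒞}` (colours `𝒞 = Fin n`) be loopless digraphs on a vertex set of
size `n` with minimum semi-degree at least `⌈n/2⌉`, let `A ∪ B` be a vertex partition
(`B = Aᶜ`) with `|A| = ⌈n/2⌉ + γn`, and let `𝒞' ∪ 𝒞''` be a colour partition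
(`𝒞'' = 𝒞'ᶜ`) with `|𝒞''| ≤ δn`.  If `D i[B]` has no edges for all `i ∈ 𝒞'`, then
`𝒟` contains a transversal directed Hamilton cycle. -/
theorem extremal_B_empty_hamilton :
    ∃ δ0 : ℝ, 0 < δ0 ∧ ∀ δ : ℝ, 0 < δ → δ ≤ δ0 →
    ∃ n0 : ℕ, ∀ n : ℕ, n0 ≤ n →
    ∀ γ : ℝ, 0 ≤ γ → γ ≤ 3 * δ →
    ∀ D : Fin n → Fin n → Fin n → Prop,
    (∀ i v, ¬ D i v v) →
    (∀ i v, (n + 1) / 2 ≤ outDeg (D i) v ∧ (n + 1) / 2 ≤ inDeg (D i) v) →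
    ∀ A : Finset (Fin n), (A.card : ℝ) = (((n + 1) / 2 : ℕ) : ℝ) + γ * n →
    ∀ C' : Finset (Fin n), ((C'ᶜ.card : ℝ) ≤ δ * n) →
    (∀ i ∈ C', ∀ u ∈ Aᶜ, ∀ v ∈ Aᶜ, ¬ D i u v) →
    ∃ σ φ : Fin n ≃ Fin n, ∀ k : Fin n, D (φ k) (σ k) (σ (finRotate n k)) := by
  classical
  refine ⟨1 / 10 ^ 7, by positivity, fun δ hδ hδ0 => ⟨⌈1 / δ⌉₊, fun n hn γ hγ hγδ D hloop hdeg A hA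
    C' hC' hB => ?_⟩⟩
  have hδn : 1 ≤ δ * n := by
    have h1 := Nat.ceil_le.1 hn
    rwa [div_le_iff₀ hδ, mul_comm] at h1
  have hn0 : (0 : ℝ) < n := pos_of_mul_pos_right (by linarith) hδ.le
  have hAge : (n + 1) / 2 ≤ A.card := by
    have : (((n + 1) / 2 : ℕ) : ℝ) ≤ A.card := by rw [hA]; linarith [mul_nonneg hγ hn0.le]
    exact_mod_cast this
  obtain ⟨p, hp⟩ := Nat.exists_eq_add_of_le hAge
  have hq := Nat.le_ceil (δ * n)
  have hq' := Nat.ceil_lt_add_one (mul_nonneg hδ.le hn0.le)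
  have hE : TransversalHamilton.IsExtremal D A C' n p ⌈δ * n⌉₊ := by
    refine ⟨Fintype.card_fin n, Fintype.card_fin n, hloop, fun i v => ?_, fun i v => ?_, hp, ?_,
      fun i hi u hu v hv => hB i hi u (mem_compl.2 hu) v (mem_compl.2 hv), ?_,
      Nat.ceil_pos.2 (by linarith), ?_⟩
    · refine (hdeg i v).1.trans_eq ?_
      rw [outDeg, Nat.card_eq_fintype_card, Fintype.card_subtype]
    · refine (hdeg i v).2.trans_eq ?_
      rw [inDeg, Nat.card_eq_fintype_card, Fintype.card_subtype]
    · have h1 : C'ᶜ.card ≤ ⌈δ * n⌉₊ := by exact_mod_cast hC'.trans hq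
      convert h1
    · have h1 : (p : ℝ) = γ * n := by
        rw [hp] at hA
        push_cast at hA
        linarith
      have h2 : (p : ℝ) ≤ 3 * (⌈δ * n⌉₊ : ℝ) := by
        nlinarith [mul_le_mul_of_nonneg_right hγδ hn0.le]
      exact_mod_cast h2
    · have h1 := mul_le_mul_of_nonneg_right hδ0 hn0.le
      have h2 : 1000000 * (⌈δ * n⌉₊ : ℝ) ≤ n := by linarith
      exact_mod_cast h2
  obtain ⟨τ, hτ, col, hcol, hD⟩ := hE.exists_isCycleOn
  exact TransversalHamilton.exists_transversal_of_isCycleOn (by exact_mod_cast hn0) D τ hτ col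
    hcol hD
end

section
/- Let 0 < 1/n ≪ μ ≪ α ≪ γ ≪ 1. Let 𝒟 = {D_1, …, D_n} be a collection of digraphs on a common vertex set V of size n with δ⁰(𝒟) ≥ (1/2 − μ)n. If at least γn of the digraphs D_i are α-nice, then 𝒟 contains a transversal directed Hamilton cycle. -/
open Finset
open scoped Classical

/-- `e_D(A, B)`: number of edges of the digraph `D` directed from `A` to `B`
(the sets need not be disjoint). -/
noncomputable def eDi {n : ℕ} (D : Fin n → Fin n → Prop)
    (A B : Finset (Fin n)) : ℕ :=
  Nat.card {p : Fin n × Fin n // p.1 ∈ A ∧ p.2 ∈ B ∧ D p.1 p.2}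

/-- A digraph `D` on an `n`-set is `α`-nice if `e_D(A, B) ≥ αn²` for all (not
necessarily disjoint) `A, B` of size at least `(1/2 − α)n`. -/
def niceDi {n : ℕ} (α : ℝ) (D : Fin n → Fin n → Prop) : Prop :=
  ∀ A B : Finset (Fin n), (1/2 - α) * (n : ℝ) ≤ A.card → (1/2 - α) * (n : ℝ) ≤ B.card →
    α * (n : ℝ) ^ 2 ≤ (eDi D A B : ℝ)

/-- Every cycle of `π` has length at least `L`. -/
def LongCycles {α : Type*} (L : ℕ) (π : Equiv.Perm α) : Prop :=
  ∀ v j, 0 < j → j < L → (π ^ j) v ≠ v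

/-- `x` and `y` are at distance at least `L` along the cycles of `π`, in both directions. -/
def FarApart {α : Type*} (L : ℕ) (π : Equiv.Perm α) (x y : α) : Prop :=
  ∀ j, j < L → (π ^ j) x ≠ y ∧ (π ^ j) y ≠ x

lemma FarApart.symm {α : Type*} {L : ℕ} {π : Equiv.Perm α} {x y : α} (h : FarApart L π x y) :
    FarApart L π y x := fun j hj => (h j hj).symm

lemma pow_swap_eq {α : Type*} [DecidableEq α] (π : Equiv.Perm α) (x y : α) (i : ℕ) (hi : 0 < i)
    (h : ∀ t, 0 < t → t < i → (π ^ t) y ≠ x ∧ (π ^ t) y ≠ y) :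
    ((π * Equiv.swap x y) ^ i) x = (π ^ i) y := by
  induction i with
  | zero => omega
  | succ k ih =>
    rcases Nat.eq_zero_or_pos k with rfl | hk
    · simp
    · rw [pow_succ', Equiv.Perm.mul_apply, ih hk (fun t h0 h1 => h t h0 (by omega)),
        Equiv.Perm.mul_apply, Equiv.swap_apply_of_ne_of_ne (h k hk (by omega)).1
        (h k hk (by omega)).2, pow_succ' π, Equiv.Perm.mul_apply]

lemma pow_swap_eq_of_avoid {α : Type*} [DecidableEq α] (π : Equiv.Perm α) (x y v : α) (i : ℕ)
    (h : ∀ t, t < i → ((π * Equiv.swap x y) ^ t) v ≠ x ∧ ((π * Equiv.swap x y) ^ t) v ≠ y) :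
    ((π * Equiv.swap x y) ^ i) v = (π ^ i) v := by
  induction i with
  | zero => simp
  | succ k ih =>
    rw [pow_succ' π, Equiv.Perm.mul_apply, ← ih (fun t ht => h t (by omega)), pow_succ',
      Equiv.Perm.mul_apply, Equiv.Perm.mul_apply,
      Equiv.swap_apply_of_ne_of_ne (h k (by omega)).1 (h k (by omega)).2]

lemma LongCycles.swap_ne {α : Type*} [DecidableEq α] {L : ℕ} {π : Equiv.Perm α} {x y : α}
    (hπ : LongCycles L π) (h : FarApart L π x y) (j : ℕ) (h0 : 0 < j) (hj : j < L) :
    ((π * Equiv.swap x y) ^ j) x ≠ x := by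
  rw [pow_swap_eq π x y j h0]
  · exact (h j hj).2
  · exact fun t h0 ht => ⟨(h t (by omega)).2, hπ y t h0 (by omega)⟩

lemma LongCycles.mul_swap {α : Type*} [DecidableEq α] {L : ℕ} {π : Equiv.Perm α} {x y : α}
    (hπ : LongCycles L π) (h : FarApart L π x y) : LongCycles L (π * Equiv.swap x y) := by
  intro v j h0 hj hv
  by_cases hav : ∀ t, t < j →
      ((π * Equiv.swap x y) ^ t) v ≠ x ∧ ((π * Equiv.swap x y) ^ t) v ≠ y
  · exact hπ v j h0 hj (by rw [← pow_swap_eq_of_avoid π x y v j hav, hv])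
  · push Not at hav
    obtain ⟨t, -, ht⟩ := hav
    have key : ((π * Equiv.swap x y) ^ j) (((π * Equiv.swap x y) ^ t) v)
        = ((π * Equiv.swap x y) ^ t) v := by
      rw [← Equiv.Perm.mul_apply, ← pow_add, add_comm, pow_add, Equiv.Perm.mul_apply, hv]
    by_cases hx : ((π * Equiv.swap x y) ^ t) v = x
    · rw [hx] at key
      exact hπ.swap_ne h j h0 hj key
    · rw [ht hx] at key
      rw [Equiv.swap_comm] at key
      exact hπ.swap_ne h.symm j h0 hj key

/-- The vertices at distance less than `L` from `x` along the cycles of `π`. -/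
noncomputable def nearSet {α : Type*} (L : ℕ) (π : Equiv.Perm α) (x : α) : Finset α :=
  (range L).image (fun j => (π ^ j) x) ∪ (range L).image (fun j => (π ^ j)⁻¹ x)

lemma card_nearSet_le {α : Type*} (L : ℕ) (π : Equiv.Perm α) (x : α) :
    (nearSet L π x).card ≤ 2 * L := by
  have h1 := card_image_le (s := range L) (f := fun j => (π ^ j) x)
  have h2 := card_image_le (s := range L) (f := fun j => (π ^ j)⁻¹ x)
  rw [card_range] at h1 h2
  exact (card_union_le _ _).trans (by omega)

lemma farApart_of_notMem_nearSet {α : Type*} {L : ℕ} {π : Equiv.Perm α} {x y : α}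
    (h : y ∉ nearSet L π x) : FarApart L π x y := by
  intro j hj
  simp only [nearSet, mem_union, mem_image, mem_range, not_or, not_exists, not_and] at h
  refine ⟨h.1 j hj, fun e => h.2 j hj ?_⟩
  rw [← e]; simp

lemma sameCycle_mul_swap {α : Type*} [Fintype α] [DecidableEq α] {π : Equiv.Perm α} {x y : α}
    (h : ¬ π.SameCycle x y) : (π * Equiv.swap x y).SameCycle x y := by
  have hex : ∃ m, 0 < m ∧ (π ^ m) y = y :=
    ⟨orderOf π, orderOf_pos π, by rw [pow_orderOf_eq_one]; rfl⟩
  have hm := Nat.find_spec hex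
  refine ⟨(Nat.find hex : ℕ), ?_⟩
  rw [zpow_natCast, pow_swap_eq π x y _ hm.1, hm.2]
  intro t h0 ht
  refine ⟨fun e => h ?_, fun e => Nat.find_min hex ht ⟨h0, e⟩⟩
  exact Equiv.Perm.SameCycle.symm ⟨(t : ℤ), by rw [zpow_natCast, e]⟩

lemma Equiv.Perm.SameCycle.mul_swap {α : Type*} [Fintype α] [DecidableEq α] {π : Equiv.Perm α}
    {x y v w : α} (h : ¬ π.SameCycle x y) (hvw : π.SameCycle v w) :
    (π * Equiv.swap x y).SameCycle v w := by
  have hxy := sameCycle_mul_swap h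
  have step : ∀ u, (π * Equiv.swap x y).SameCycle u (π u) := by
    intro u
    by_cases hx : u = x
    · subst hx
      refine hxy.trans ⟨1, ?_⟩
      simp
    by_cases hy : u = y
    · subst hy
      refine hxy.symm.trans ⟨1, ?_⟩
      simp
    · exact ⟨1, by simp [Equiv.swap_apply_of_ne_of_ne hx hy]⟩
  obtain ⟨i, rfl⟩ := hvw.exists_nat_pow_eq
  clear hvw
  induction i with
  | zero => exact Equiv.Perm.SameCycle.refl _ _
  | succ k ih => rw [pow_succ', Equiv.Perm.mul_apply]; exact ih.trans (step _)

/-- `R` meets every cycle of `π`. -/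
def MeetsCycles {α : Type*} (π : Equiv.Perm α) (R : Finset α) : Prop :=
  ∀ v, ∃ r ∈ R, π.SameCycle r v

lemma MeetsCycles.mul_swap {α : Type*} [Fintype α] [DecidableEq α] {π : Equiv.Perm α}
    {R : Finset α} (h : MeetsCycles π R) (x y : α) :
    MeetsCycles (π * Equiv.swap x y) (insert x (insert y R)) := by
  intro v
  by_cases hav : ∀ t, ((π * Equiv.swap x y) ^ t) v ≠ x ∧ ((π * Equiv.swap x y) ^ t) v ≠ y
  · obtain ⟨r, hr, hrv⟩ := h v
    obtain ⟨i, hi⟩ := hrv.symm.exists_nat_pow_eq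
    refine ⟨r, by simp [hr], Equiv.Perm.SameCycle.symm ⟨(i : ℤ), ?_⟩⟩
    rw [zpow_natCast, pow_swap_eq_of_avoid π x y v i (fun t _ => hav t), hi]
  · push Not at hav
    obtain ⟨t, ht⟩ := hav
    by_cases hx : ((π * Equiv.swap x y) ^ t) v = x
    · exact ⟨x, by simp, Equiv.Perm.SameCycle.symm ⟨(t : ℤ), by rw [zpow_natCast, hx]⟩⟩
    · exact ⟨y, by simp, Equiv.Perm.SameCycle.symm ⟨(t : ℤ), by rw [zpow_natCast, ht hx]⟩⟩

lemma LongCycles.exists_meetsCycles {α : Type*} [Fintype α] {L : ℕ} {π : Equiv.Perm α}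
    (h : LongCycles L π) : ∃ R : Finset α, MeetsCycles π R ∧ R.card * L ≤ Fintype.card α := by
  let s := Equiv.Perm.SameCycle.setoid π
  let rep : α → α := fun v => (Quotient.mk s v).out
  have hrep : ∀ v, π.SameCycle (rep v) v := fun v =>
    Quotient.exact (s := s) (Quotient.out_eq (Quotient.mk s v))
  have hrep' : ∀ v w, π.SameCycle v w → rep v = rep w := fun v w hvw => by
    have : Quotient.mk s v = Quotient.mk s w := Quotient.sound hvw
    simp only [rep, this]
  refine ⟨univ.image rep, fun v => ⟨rep v, by simp, hrep v⟩, ?_⟩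
  have := card_nsmul_le_sum (univ.image rep) (fun r => (univ.filter (fun v => rep v = r)).card) L ?_
  · rw [smul_eq_mul] at this
    rwa [← card_eq_sum_card_image, card_univ] at this
  · intro r hr
    obtain ⟨w, -, rfl⟩ := mem_image.1 hr
    have hinj : Set.InjOn (fun j => (π ^ j) w) (range L : Set ℕ) := by
      have aux : ∀ i j, i < j → j < L → (π ^ i) w ≠ (π ^ j) w := by
        intro i j hij hj e
        apply h w (j - i) (by omega) (by omega)
        apply (π ^ i).injective
        rw [← Equiv.Perm.mul_apply, ← pow_add, show i + (j - i) = j by omega, e]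
      intro i hi j hj e
      simp only [coe_range, Set.mem_Iio] at hi hj
      rcases lt_trichotomy i j with hij | hij | hij
      · exact absurd e (aux i j hij hj)
      · exact hij
      · exact absurd e.symm (aux j i hij hi)
    rw [← card_range L, ← card_image_of_injOn hinj]
    apply card_le_card
    intro v hv
    obtain ⟨j, -, rfl⟩ := mem_image.1 hv
    simp only [mem_filter, mem_univ, true_and]
    exact hrep' _ _ (Equiv.Perm.SameCycle.symm ⟨(j : ℤ), by rw [zpow_natCast]⟩)

/-- The permutation `π` and the colouring `φ` give a coloured 1-factor in which every edge
`v → π v` with `v ∉ S` is present in its colour `φ v`, which agrees with `π₀` and `φ₀` on the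
set `Z` of frozen vertices, and all of whose cycles have length at least `L`. -/
structure PartialFactor {n : ℕ} (D : Fin n → Fin n → Fin n → Prop) (L : ℕ)
    (Z : Finset (Fin n)) (π₀ φ₀ : Equiv.Perm (Fin n)) (S : Finset (Fin n))
    (π φ : Equiv.Perm (Fin n)) : Prop where
  good : ∀ v, v ∉ S → D (φ v) v (π v)
  frozen : ∀ z ∈ Z, z ∉ S ∧ π z = π₀ z ∧ φ z = φ₀ z
  long : LongCycles L π

/-- Every digraph has minimum semi-degree at least `k`. -/
def MinSemidegree {n : ℕ} (D : Fin n → Fin n → Fin n → Prop) (k : ℕ) : Prop :=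
  ∀ i v, k ≤ (univ.filter (fun w => D i v w)).card ∧ k ≤ (univ.filter (fun w => D i w v)).card

/-- There are at least `q` edges from `A` to `B` in `D`, whenever `A` and `B` have size at
least `k`. -/
def DenseBetween {n : ℕ} (D : Fin n → Fin n → Prop) (k q : ℕ) : Prop :=
  ∀ A B : Finset (Fin n), k ≤ A.card → k ≤ B.card →
    q ≤ (univ.filter (fun p : Fin n × Fin n => p.1 ∈ A ∧ p.2 ∈ B ∧ D p.1 p.2)).card

section Steps

variable {n : ℕ} {D : Fin n → Fin n → Fin n → Prop} {L : ℕ} {Z : Finset (Fin n)}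
  {π₀ φ₀ : Equiv.Perm (Fin n)} {S : Finset (Fin n)} {π φ : Equiv.Perm (Fin n)} {k q : ℕ}

lemma exists_switch_vertex (hdeg : MinSemidegree D k) (i j : Fin n) (b a : Fin n)
    (π : Equiv.Perm (Fin n)) (S E : Finset (Fin n)) (h : n + 2 * E.card < 2 * k + S.card) :
    ∃ x, x ∉ E ∧ ((x ∈ S ∧ (D i b (π x) ∨ D j x a)) ∨ (D i b (π x) ∧ D j x a)) := by
  by_contra! hcon
  set X₁ := univ.filter (fun x => D i b (π x)) with hX₁
  set X₂ := univ.filter (fun x => D j x a) with hX₂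
  have c₁ : k ≤ X₁.card := by
    refine (hdeg i b).1.trans (card_le_card_of_injOn π.symm ?_ π.symm.injective.injOn)
    intro w hw
    simpa [hX₁] using hw
  have c₂ : k ≤ X₂.card := (hdeg j a).2
  have hinter : X₁ ∩ X₂ ⊆ E := by
    intro x hx
    by_contra hxE
    simp only [hX₁, hX₂, mem_inter, mem_filter, mem_univ, true_and] at hx
    exact (hcon x hxE).2 hx.1 hx.2
  have hunion : X₁ ∪ X₂ ⊆ (univ \ S) ∪ E := by
    intro x hx
    simp only [hX₁, hX₂, mem_union, mem_filter, mem_univ, true_and, mem_sdiff] at hx ⊢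
    by_contra! hxE
    have := (hcon x hxE.2).1 hxE.1
    tauto
  have h₁ := card_le_card hinter
  have h₂ := (card_le_card hunion).trans (card_union_le _ _)
  have h₃ := card_union_add_card_inter X₁ X₂
  have h₄ : (univ \ S).card + S.card = n := by
    rw [card_sdiff_add_card_eq_card (subset_univ S)]; simp
  omega

lemma PartialFactor.two_switch (hT : PartialFactor D L Z π₀ φ₀ S π φ) (hdeg : MinSemidegree D k)
    {b b₂ : Fin n} (hb : b ∈ S) (hb₂ : b₂ ∈ S) (hne : b ≠ b₂)
    (hcard : n + 2 * (Z.card + 2 * L + 2) < 2 * k + S.card)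
    {N : Finset (Fin n)} (hN : ∀ c ∈ N, φ.symm c ∈ S) (hbN : φ b ∉ N) (hb₂N : φ b₂ ∉ N) :
    ∃ S' π' φ', PartialFactor D L Z π₀ φ₀ S' π' φ' ∧ S'.card < S.card ∧
      ∀ c ∈ N, φ'.symm c ∈ S' := by
  have hE : (Z ∪ nearSet L π b ∪ {b, b₂}).card ≤ Z.card + 2 * L + 2 := by
    refine (card_union_le _ _).trans (add_le_add ((card_union_le _ _).trans ?_) card_le_two)
    exact add_le_add le_rfl (card_nearSet_le L π b)
  obtain ⟨x, hxE, hx⟩ := exists_switch_vertex hdeg (φ b) (φ b₂) b (π b) π S _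
    (lt_of_le_of_lt (by gcongr) hcard)
  simp only [mem_union, mem_insert, mem_singleton, not_or] at hxE
  obtain ⟨⟨hxZ, hxnear⟩, hxb, hxb₂⟩ := hxE
  have hlong : LongCycles L (π * Equiv.swap b x) :=
    hT.long.mul_swap (farApart_of_notMem_nearSet hxnear)
  have hπ' : ∀ v, (π * Equiv.swap b x) v = if v = b then π x else if v = x then π b else π v := by
    intro v; rw [Equiv.Perm.mul_apply, Equiv.swap_apply_def]; split_ifs <;> rfl
  have hφ' : ∀ v, (φ * Equiv.swap x b₂) v =
      if v = x then φ b₂ else if v = b₂ then φ x else φ v := by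
    intro v; rw [Equiv.Perm.mul_apply, Equiv.swap_apply_def]; split_ifs <;> rfl
  have hsymm : ∀ c, (φ * Equiv.swap x b₂).symm c = Equiv.swap x b₂ (φ.symm c) := by
    intro c
    rw [Equiv.symm_apply_eq, Equiv.Perm.mul_apply, Equiv.swap_apply_self, Equiv.apply_symm_apply]
  have hfr := hT.frozen
  have hg := hT.good
  have hNb : ∀ c ∈ N, φ.symm c ≠ b ∧ φ.symm c ≠ b₂ := by
    intro c hc
    constructor
    · rintro rfl; simp [hc] at hbN
    · rintro rfl; simp [hc] at hb₂N
  by_cases hB : x ∈ S ∧ D (φ b₂) x (π b)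
  · refine ⟨S.erase x, _, φ * Equiv.swap x b₂, ⟨?_, ?_, hlong⟩, card_erase_lt_of_mem hB.1, ?_⟩
    · intro v hv
      rw [hπ', hφ']
      grind
    · intro z hz
      rw [hπ', hφ']
      grind
    · intro c hc
      rw [hsymm, Equiv.swap_apply_def]
      grind
  · refine ⟨S.erase b, _, φ * Equiv.swap x b₂, ⟨?_, ?_, hlong⟩, card_erase_lt_of_mem hb, ?_⟩
    · intro v hv
      rw [hπ', hφ']
      grind
    · intro z hz
      rw [hπ', hφ']
      grind
    · intro c hc
      rw [hsymm, Equiv.swap_apply_def]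
      grind

lemma PartialFactor.exists_reserved (hT : PartialFactor D L Z π₀ φ₀ S π φ)
    (hdeg : MinSemidegree D k) {N : Finset (Fin n)} (hN : ∀ c ∈ N, φ.symm c ∈ S)
    (hcard : n + 2 * (Z.card + 2 * L + 2) < 2 * k + (N.card + 2)) :
    ∃ S' π' φ', PartialFactor D L Z π₀ φ₀ S' π' φ' ∧ (S'.filter (fun v => φ' v ∉ N)).card ≤ 2 := by
  induction hs : S.card using Nat.strong_induction_on generalizing S π φ with
  | _ s ih =>
  by_cases hsmall : (S.filter (fun v => φ v ∉ N)).card ≤ 2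
  · exact ⟨S, π, φ, hT, hsmall⟩
  · push Not at hsmall
    obtain ⟨b, hb, b₂, hb₂, hne⟩ := one_lt_card.1 (lt_trans (by norm_num) hsmall)
    simp only [mem_filter] at hb hb₂
    have hNS : N.card ≤ (S.filter (fun v => φ v ∈ N)).card := by
      refine card_le_card_of_injOn φ.symm ?_ φ.symm.injective.injOn
      intro c hc
      simpa using ⟨hN c hc, hc⟩
    have hsplit := card_filter_add_card_filter_not (s := S) (fun v => φ v ∈ N)
    obtain ⟨S', π', φ', hT', hlt, hN'⟩ := hT.two_switch hdeg hb.1 hb₂.1 hne (by omega) hN hb.2 hb₂.2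
    exact ih _ (hs ▸ hlt) hT' hN' rfl

lemma PartialFactor.three_switch (hT : PartialFactor D L Z π₀ φ₀ S π φ) (hL : 0 < L)
    (hdeg : MinSemidegree D k)
    {b b₂ b₃ : Fin n} (hb : b ∈ S) (hb₂ : b₂ ∈ S) (hb₃ : b₃ ∈ S) (hne : b ≠ b₂) (hne₃ : b ≠ b₃)
    (hne₂₃ : b₂ ≠ b₃) (hdense : DenseBetween (D (φ b₃)) k q)
    (hq : 2 * (n * (Z.card + 2 * L + 3)) < q)
    {N : Finset (Fin n)} (hN : ∀ v ∈ S, φ v ∉ N → v = b ∨ v = b₂) :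
    ∃ S' π' φ', PartialFactor D L Z π₀ φ₀ S' π' φ' ∧ S'.card < S.card ∧
      (S'.filter (fun v => φ' v ∉ N)).card ≤ 2 := by
  set X₁ := univ.filter (fun x => D (φ b) b (π x)) with hX₁
  set Y := univ.filter (fun y => D (φ b₂) (π.symm y) (π b)) with hY
  have c₁ : k ≤ X₁.card := by
    refine (hdeg (φ b) b).1.trans (card_le_card_of_injOn π.symm ?_ π.symm.injective.injOn)
    intro w hw
    simpa [hX₁] using hw
  have c₂ : k ≤ Y.card := by
    refine (hdeg (φ b₂) (π b)).2.trans (card_le_card_of_injOn π ?_ π.injective.injOn)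
    intro w hw
    simpa [hY] using hw
  have hE : ∀ (ρ : Equiv.Perm (Fin n)) v,
      (Z ∪ nearSet L ρ v ∪ {b, b₂, b₃}).card ≤ Z.card + 2 * L + 3 := by
    intro ρ v
    refine (card_union_le _ _).trans (add_le_add ((card_union_le _ _).trans ?_) card_le_three)
    exact add_le_add le_rfl (card_nearSet_le L ρ v)
  set F₁ : Finset (Fin n × Fin n) := (Z ∪ nearSet L π b ∪ {b, b₂, b₃}) ×ˢ univ with hF₁
  set F₂ : Finset (Fin n × Fin n) := univ.biUnion (fun x =>
    (Z ∪ nearSet L (π * Equiv.swap b x) x ∪ {b, b₂, b₃}).image (fun y => (x, π y))) with hF₂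
  have hF₁c : F₁.card ≤ n * (Z.card + 2 * L + 3) := by
    rw [hF₁, card_product, card_univ, Fintype.card_fin, mul_comm]
    exact Nat.mul_le_mul_left _ (hE _ _)
  have hF₂c : F₂.card ≤ n * (Z.card + 2 * L + 3) := by
    refine card_biUnion_le.trans ((sum_le_card_nsmul univ _ (Z.card + 2 * L + 3) ?_).trans ?_)
    · intro x _
      exact card_image_le.trans (hE _ _)
    · simp
  have hex : ∃ p ∈ univ.filter (fun p : Fin n × Fin n => p.1 ∈ X₁ ∧ p.2 ∈ Y ∧ D (φ b₃) p.1 p.2),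
      p ∉ F₁ ∪ F₂ := by
    apply exists_mem_notMem_of_card_lt_card
    have := hdense X₁ Y c₁ c₂
    have := card_union_le F₁ F₂
    omega
  obtain ⟨⟨x, y⟩, hp, hpF⟩ := hex
  obtain ⟨z, rfl⟩ := π.surjective y
  simp only [hX₁, hY, hF₁, hF₂, mem_filter, mem_univ, true_and, Equiv.symm_apply_apply, mem_union,
    mem_product, mem_biUnion, mem_image, mem_insert, mem_singleton, and_true, not_or, not_exists,
    not_and, Prod.mk.injEq] at hp hpF
  obtain ⟨hbx, hzb, hxz⟩ := hp
  obtain ⟨⟨⟨hxZ, hxnear⟩, hxb, hxb₂, hxb₃⟩, hpF₂⟩ := hpF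
  have hz : z ∉ Z ∧ z ∉ nearSet L (π * Equiv.swap b x) x ∧ z ≠ b ∧ z ≠ b₂ ∧ z ≠ b₃ := by
    refine ⟨?_, ?_, ?_, ?_, ?_⟩ <;> intro h <;> exact hpF₂ x z (by tauto) rfl rfl
  clear hpF₂
  obtain ⟨hzZ, hznear, hz1, hz2, hz3⟩ := hz
  have hlong : LongCycles L (π * Equiv.swap b x * Equiv.swap x z) :=
    (hT.long.mul_swap (farApart_of_notMem_nearSet hxnear)).mul_swap
      (farApart_of_notMem_nearSet hznear)
  have hxz' : x ≠ z := by
    rintro rfl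
    exact (farApart_of_notMem_nearSet hznear 0 hL).1 rfl
  have hπ' : ∀ v, (π * Equiv.swap b x * Equiv.swap x z) v =
      if v = b then π x else if v = x then π z else if v = z then π b else π v := by
    intro v
    simp only [Equiv.Perm.mul_apply, Equiv.swap_apply_def]
    grind
  have hφ' : ∀ v, (φ * Equiv.swap x b₃ * Equiv.swap z b₂) v =
      if v = x then φ b₃ else if v = b₃ then φ x else if v = z then φ b₂ else
        if v = b₂ then φ z else φ v := by
    intro v
    simp only [Equiv.Perm.mul_apply, Equiv.swap_apply_def]
    grind
  have hfr := hT.frozen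
  have hg := hT.good
  refine ⟨S \ {b, x, z}, _, φ * Equiv.swap x b₃ * Equiv.swap z b₂, ⟨?_, ?_, hlong⟩, ?_, ?_⟩
  · intro v hv
    simp only [mem_sdiff, mem_insert, mem_singleton] at hv
    rw [hπ', hφ']
    grind
  · intro w hw
    simp only [mem_sdiff, mem_insert, mem_singleton]
    rw [hπ', hφ']
    grind
  · refine card_lt_card ⟨sdiff_subset, fun h => ?_⟩
    have := h hb
    simp at this
  · refine (card_le_card (t := {b₂, b₃}) ?_).trans card_le_two
    intro v hv
    simp only [mem_filter, mem_sdiff, mem_insert, mem_singleton, hφ'] at hv ⊢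
    grind

lemma PartialFactor.exists_card_le_two (hT : PartialFactor D L Z π₀ φ₀ S π φ) (hL : 0 < L)
    (hdeg : MinSemidegree D k) {N : Finset (Fin n)} (hdense : ∀ c ∈ N, DenseBetween (D c) k q)
    (hq : 2 * (n * (Z.card + 2 * L + 3)) < q) (hN : (S.filter (fun v => φ v ∉ N)).card ≤ 2) :
    ∃ S' π' φ', PartialFactor D L Z π₀ φ₀ S' π' φ' ∧ S'.card ≤ 2 := by
  induction hs : S.card using Nat.strong_induction_on generalizing S π φ with
  | _ s ih =>
  by_cases hsmall : S.card ≤ 2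
  · exact ⟨S, π, φ, hT, hsmall⟩
  · push Not at hsmall
    obtain ⟨B, hBN, hBS, hB⟩ := exists_subsuperset_card_eq (filter_subset _ _) hN hsmall.le
    obtain ⟨b, b₂, hne, rfl⟩ := card_eq_two.1 hB
    obtain ⟨b₃, hb₃, hb₃B⟩ := exists_mem_notMem_of_card_lt_card (hB.trans_lt hsmall)
    have hcol : ∀ v ∈ S, φ v ∉ N → v = b ∨ v = b₂ := by
      intro v hv hvN
      simpa using hBN (mem_filter.2 ⟨hv, hvN⟩)
    simp only [mem_insert, mem_singleton, not_or] at hb₃B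
    have hb₃N : φ b₃ ∈ N := by
      by_contra h
      have := hcol b₃ hb₃ h
      tauto
    obtain ⟨S', π', φ', hT', hlt, hN'⟩ := hT.three_switch hL hdeg (hBS (by simp)) (hBS (by simp))
      hb₃ hne (Ne.symm hb₃B.1) (Ne.symm hb₃B.2) (hdense _ hb₃N) hq hcol
    exact ih _ (hs ▸ hlt) hT' hN' rfl

end Steps

section Absorption

variable {n : ℕ}

/-- The list `l` of coloured edges `(tail, colour, head)` contains, for all vertices `a`, `b` and
every colour `c`, an edge `(x, d, y)` with `x → a` in colour `c` and `b → y` in colour `d`. -/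
def AbsorbsAll (D : Fin n → Fin n → Fin n → Prop) (l : List (Fin n × Fin n × Fin n)) : Prop :=
  ∀ a b c, ∃ e ∈ l, D c e.1 a ∧ D e.2.1 b e.2.2

/-- The list `l` contains `k` consecutive disjoint absorbing blocks. -/
def AbsorbsTimes (D : Fin n → Fin n → Fin n → Prop) : ℕ → List (Fin n × Fin n × Fin n) → Prop
  | 0, _ => True
  | k + 1, l => ∃ l₁ l₂, l = l₁ ++ l₂ ∧ AbsorbsAll D l₁ ∧ AbsorbsTimes D k l₂

/-- The edges of the list `l` form a walk which visits every tail at most once and which is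
part of the 1-factor `π` with colouring `φ`. -/
structure PathOf (π φ : Equiv.Perm (Fin n)) (l : List (Fin n × Fin n × Fin n)) : Prop where
  frozen : ∀ e ∈ l, π e.1 = e.2.2 ∧ φ e.1 = e.2.1
  nodup : (l.map Prod.fst).Nodup
  chain : l.IsChain (fun e f => e.2.2 = f.1)

variable {D : Fin n → Fin n → Fin n → Prop} {π φ : Equiv.Perm (Fin n)} {S R : Finset (Fin n)}

lemma PathOf.sameCycle {l : List (Fin n × Fin n × Fin n)} (h : PathOf π φ l)
    {e f : Fin n × Fin n × Fin n} (he : e ∈ l) (hf : f ∈ l) : π.SameCycle e.1 f.1 := by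
  have key : ∀ (l : List (Fin n × Fin n × Fin n)) (g : Fin n × Fin n × Fin n),
      (∀ e ∈ g :: l, π e.1 = e.2.2) → (g :: l).IsChain (fun e f => e.2.2 = f.1) →
      ∀ e ∈ g :: l, π.SameCycle g.1 e.1 := by
    intro l
    induction l with
    | nil =>
      intro g _ _ e he
      rw [List.mem_singleton.1 he]
    | cons g' l ih =>
      intro g hfr hch e he
      rw [List.isChain_cons_cons] at hch
      rcases List.mem_cons.1 he with rfl | he
      · exact Equiv.Perm.SameCycle.refl _ _
      · refine Equiv.Perm.SameCycle.trans ⟨1, ?_⟩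
          (ih g' (fun e he => hfr e (List.mem_cons_of_mem _ he)) hch.2 e he)
        rw [zpow_one, hfr g (by simp), hch.1]
  cases l with
  | nil => simp at he
  | cons g l =>
    have := key l g (fun e he => (h.frozen e he).1) h.chain
    exact (this e he).symm.trans (this f hf)

lemma PathOf.mul_swap {l₁ l₂ : List (Fin n × Fin n × Fin n)} (h : PathOf π φ (l₁ ++ l₂))
    {e : Fin n × Fin n × Fin n} (he : e ∈ l₁) {b : Fin n} (hb : ∀ f ∈ l₂, f.1 ≠ b) :
    PathOf (π * Equiv.swap b e.1) (φ * Equiv.swap b e.1) l₂ := by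
  have hnd := h.nodup
  rw [List.map_append, List.nodup_append] at hnd
  refine ⟨fun f hf => ?_, hnd.2.1, (List.isChain_append.1 h.chain).2.1⟩
  have hfe : f.1 ≠ e.1 := fun heq =>
    hnd.2.2 e.1 (List.mem_map_of_mem he) f.1 (List.mem_map_of_mem hf) heq.symm
  rw [Equiv.Perm.mul_apply, Equiv.Perm.mul_apply, Equiv.swap_apply_of_ne_of_ne (hb f hf) hfe]
  exact h.frozen f (List.mem_append_right _ hf)

lemma good_mul_swap (hg : ∀ v, v ∉ S → D (φ v) v (π v)) {b x : Fin n}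
    (hx : D (φ b) x (π b)) (hb : D (φ x) b (π x)) :
    ∀ v, v ∉ S.erase b → D ((φ * Equiv.swap b x) v) v ((π * Equiv.swap b x) v) := by
  intro v hv
  simp only [Equiv.Perm.mul_apply, Equiv.swap_apply_def]
  grind

lemma exists_fill {r : ℕ} {l : List (Fin n × Fin n × Fin n)}
    (hg : ∀ v, v ∉ S → D (φ v) v (π v)) (hl : PathOf π φ l) (hS : ∀ e ∈ l, e.1 ∉ S)
    (hab : AbsorbsTimes D (S.card + r) l) (hR : MeetsCycles π R) :
    ∃ (π' φ' : Equiv.Perm (Fin n)) (l' : List (Fin n × Fin n × Fin n)) (R' : Finset (Fin n)),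
      (∀ v, D (φ' v) v (π' v)) ∧ PathOf π' φ' l' ∧ AbsorbsTimes D r l' ∧ MeetsCycles π' R' ∧
      R'.card ≤ R.card + 2 * S.card := by
  induction hs : S.card generalizing S π φ l R with
  | zero =>
    rw [card_eq_zero] at hs
    subst hs
    rw [card_empty, zero_add] at hab
    exact ⟨π, φ, l, R, fun v => hg v (by simp), hl, hab, hR, by simp⟩
  | succ s ih =>
    obtain ⟨b, hb⟩ : S.Nonempty := card_pos.1 (by omega)
    rw [hs, show s + 1 + r = (s + r) + 1 by ring] at hab
    obtain ⟨l₁, l₂, rfl, h₁, h₂⟩ := hab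
    obtain ⟨e, he, hea, heb⟩ := h₁ (π b) b (φ b)
    have hfe := hl.frozen e (List.mem_append_left _ he)
    rw [← hfe.1, ← hfe.2] at heb
    have hs' : (S.erase b).card = s := by rw [card_erase_of_mem hb, hs]; rfl
    obtain ⟨π', φ', l', R', hg', hl', hab', hR', hc⟩ := ih (good_mul_swap hg hea heb)
      (hl.mul_swap he (fun f hf hfb => hS f (List.mem_append_right _ hf) (hfb ▸ hb)))
      (fun f hf hfS => hS f (List.mem_append_right _ hf) (mem_of_mem_erase hfS))
      (by rwa [hs']) (hR.mul_swap b e.1) hs'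
    refine ⟨π', φ', l', R', hg', hl', hab', hR', hc.trans ?_⟩
    have h₁ := card_insert_le b (insert e.1 R)
    have h₂ := card_insert_le e.1 R
    omega

lemma MeetsCycles.mul_swap_erase (hR : MeetsCycles π R) {x y : Fin n} (h : ¬ π.SameCycle x y) :
    ∃ R' : Finset (Fin n), R'.card < R.card ∧ MeetsCycles (π * Equiv.swap x y) R' := by
  obtain ⟨r, hr, hrx⟩ := hR x
  obtain ⟨s, hs, hsy⟩ := hR y
  have hsr : s ≠ r := by
    rintro rfl
    exact h (hrx.symm.trans hsy)
  refine ⟨R.erase r, card_erase_lt_of_mem hr, fun v => ?_⟩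
  obtain ⟨t, ht, htv⟩ := hR v
  by_cases htr : t = r
  · subst htr
    refine ⟨s, mem_erase.2 ⟨hsr, hs⟩, ?_⟩
    exact ((hsy.mul_swap h).trans (sameCycle_mul_swap h).symm).trans
      ((hrx.symm.trans htv).mul_swap h)
  · exact ⟨t, mem_erase.2 ⟨htr, ht⟩, htv.mul_swap h⟩

lemma exists_merge {r : ℕ} {l : List (Fin n × Fin n × Fin n)}
    (hg : ∀ v, D (φ v) v (π v)) (hl : PathOf π φ l)
    (hab : AbsorbsTimes D r l) (hR : MeetsCycles π R) (hr : R.card ≤ r) :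
    ∃ π' φ' : Equiv.Perm (Fin n), (∀ v, D (φ' v) v (π' v)) ∧ ∀ v w, π'.SameCycle v w := by
  induction r generalizing π φ l R with
  | zero =>
    refine ⟨π, φ, hg, fun v w => ?_⟩
    obtain ⟨s, hs, -⟩ := hR v
    rw [card_eq_zero.1 (Nat.le_zero.1 hr)] at hs
    simp at hs
  | succ r ih =>
    by_cases hsing : ∀ v w, π.SameCycle v w
    · exact ⟨π, φ, hg, hsing⟩
    obtain ⟨l₁, l₂, rfl, h₁, h₂⟩ := hab
    obtain ⟨b, hb⟩ : ∃ b, ∀ f ∈ l₁ ++ l₂, ¬ π.SameCycle b f.1 := by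
      by_contra! hcon
      apply hsing
      intro v w
      obtain ⟨f, hf, hvf⟩ := hcon v
      obtain ⟨g, hg, hwg⟩ := hcon w
      exact (hvf.trans (hl.sameCycle hf hg)).trans hwg.symm
    obtain ⟨e, he, hea, heb⟩ := h₁ (π b) b (φ b)
    have hfe := hl.frozen e (List.mem_append_left _ he)
    rw [← hfe.1, ← hfe.2] at heb
    obtain ⟨R', hR'c, hR'⟩ := hR.mul_swap_erase (hb e (List.mem_append_left _ he))
    refine ih (fun v => good_mul_swap (S := ∅) (fun v _ => hg v) hea heb v (by simp))
      (hl.mul_swap he (fun f hf hfb => hb f (List.mem_append_right _ hf) ?_)) h₂ hR' (by omega)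
    rw [hfb]

lemma exists_hamilton_of_sameCycle (hn : 2 ≤ n) (hg : ∀ v, D (φ v) v (π v))
    (hπ : ∀ v w, π.SameCycle v w) :
    ∃ σ ψ : Fin n ≃ Fin n, ∀ k : Fin n, D (ψ k) (σ k) (σ (finRotate n k)) := by
  obtain ⟨m, rfl⟩ : ∃ m, n = m + 2 := ⟨n - 2, by omega⟩
  have hne : ∀ v, π v ≠ v := by
    intro v hv
    obtain ⟨w, hw⟩ := exists_ne v
    obtain ⟨i, hi⟩ := hπ v w
    rw [Equiv.Perm.zpow_apply_eq_self_of_apply_eq_self hv] at hi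
    exact hw hi.symm
  have hc : π.IsCycle := ⟨0, hne 0, fun y _ => hπ 0 y⟩
  have hsupp : π.support = univ := by ext v; simp [hne]
  have hconj : IsConj (finRotate (m + 2)) π := by
    apply isCycle_finRotate.isConj hc
    rw [hsupp, support_finRotate]
  obtain ⟨σ, hσ⟩ := isConj_iff.1 hconj
  refine ⟨σ, σ.trans φ, fun k => ?_⟩
  have := hg (σ k)
  rw [← hσ] at this
  simpa using this

end Absorption

section AbsorbingPath

variable {n : ℕ} {D : Fin n → Fin n → Fin n → Prop} {N : Finset (Fin n)}

/-- The list `l` of coloured edges `(tail, colour, head)` is a path starting in a given vertex,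
whose colours are distinct and lie in `N`. -/
inductive RainbowPath (D : Fin n → Fin n → Fin n → Prop) (N : Finset (Fin n)) :
    Fin n → List (Fin n × Fin n × Fin n) → Prop
  | nil (h : Fin n) : RainbowPath D N h []
  | cons {x d h : Fin n} {l : List (Fin n × Fin n × Fin n)} (hD : D d x h) (hd : d ∈ N)
      (hdl : d ∉ l.map (fun e => e.2.1)) (hx : x ∉ h :: l.map (fun e => e.2.2))
      (hl : RainbowPath D N h l) : RainbowPath D N x ((x, d, h) :: l)

namespace RainbowPath

variable {h : Fin n} {l : List (Fin n × Fin n × Fin n)}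

lemma good (hl : RainbowPath D N h l) : ∀ e ∈ l, D e.2.1 e.1 e.2.2 ∧ e.2.1 ∈ N := by
  induction hl with
  | nil => simp
  | cons hD hd _ _ _ ih => simpa using ⟨⟨hD, hd⟩, by simpa using ih⟩

lemma nodup_colours (hl : RainbowPath D N h l) : (l.map (fun e => e.2.1)).Nodup := by
  induction hl with
  | nil => simp
  | cons _ _ hdl _ _ ih => exact List.nodup_cons.2 ⟨hdl, ih⟩

lemma nodup_vertices (hl : RainbowPath D N h l) : (h :: l.map (fun e => e.2.2)).Nodup := by
  induction hl with
  | nil => simp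
  | cons _ _ _ hx _ ih => exact List.nodup_cons.2 ⟨hx, ih⟩

lemma tails_prefix (hl : RainbowPath D N h l) :
    l.map Prod.fst <+: h :: l.map (fun e => e.2.2) := by
  induction hl with
  | nil => simp
  | cons _ _ _ _ _ ih => exact (List.prefix_cons_inj _).2 ih

lemma isChain (hl : RainbowPath D N h l) : l.IsChain (fun e f => e.2.2 = f.1) := by
  induction hl with
  | nil => simp
  | cons _ _ _ _ hl ih =>
    cases hl with
    | nil => simp
    | cons _ _ _ _ _ => exact List.isChain_cons_cons.2 ⟨rfl, ih⟩

lemma nodup_tails (hl : RainbowPath D N h l) : (l.map Prod.fst).Nodup :=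
  hl.nodup_vertices.sublist hl.tails_prefix.sublist

end RainbowPath

/-- The triples `(a, b, c)` which are not absorbed by any edge of `l`. -/
noncomputable def unabsorbed (D : Fin n → Fin n → Fin n → Prop)
    (l : List (Fin n × Fin n × Fin n)) : Finset (Fin n × Fin n × Fin n) :=
  univ.filter (fun t => ¬ ∃ e ∈ l, D t.2.2 e.1 t.1 ∧ D e.2.1 t.2.1 e.2.2)

lemma DenseBetween.le_card_avoid {k q : ℕ} {d : Fin n} (hd : DenseBetween (D d) k q)
    {A B : Finset (Fin n)} (hA : k ≤ A.card) (hB : k ≤ B.card) (F : Finset (Fin n)) :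
    q ≤ (univ.filter (fun p : Fin n × Fin n =>
      (p.1 ∉ F ∧ p.2 ∉ F ∧ D d p.1 p.2) ∧ p.1 ∈ A ∧ p.2 ∈ B)).card + 2 * (F.card * n) := by
  have h₁ : (univ.filter (fun p : Fin n × Fin n => p.1 ∈ A ∧ p.2 ∈ B ∧ D d p.1 p.2)) ⊆
      (univ.filter (fun p : Fin n × Fin n =>
        (p.1 ∉ F ∧ p.2 ∉ F ∧ D d p.1 p.2) ∧ p.1 ∈ A ∧ p.2 ∈ B)) ∪
      (F ×ˢ univ ∪ univ ×ˢ F) := by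
    intro p hp
    simp only [mem_filter, mem_univ, true_and, mem_union, mem_product, and_true] at hp ⊢
    tauto
  have h₂ := (hd A B hA hB).trans ((card_le_card h₁).trans (card_union_le _ _))
  have h₃ := card_union_le (F ×ˢ (univ : Finset (Fin n))) (univ ×ˢ F)
  rw [card_product, card_product, card_univ, Fintype.card_fin, mul_comm n] at h₃
  omega

lemma exists_absorbing_edge {k q : ℕ} {β : ℝ} (hβ : 0 < β) (hdeg : MinSemidegree D k) {d : Fin n}
    (hd : DenseBetween (D d) k q) (F : Finset (Fin n))
    (hq : β * (n : ℝ) ^ 2 + 2 * F.card * n ≤ q) (U : Finset (Fin n × Fin n × Fin n)) :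
    ∃ x y, x ∉ F ∧ y ∉ F ∧ D d x y ∧
      ((U.filter (fun t => ¬ (D t.2.2 x t.1 ∧ D d t.2.1 y))).card : ℝ) ≤ (1 - β) * U.card := by
  set P := univ.filter (fun p : Fin n × Fin n => p.1 ∉ F ∧ p.2 ∉ F ∧ D d p.1 p.2) with hP
  have hn : 0 < n := d.pos
  have hn' : (0 : ℝ) < n := by exact_mod_cast hn
  have hsub : ∀ A B : Finset (Fin n), k ≤ A.card → k ≤ B.card →
      β * (n : ℝ) ^ 2 ≤ (P.filter (fun p => p.1 ∈ A ∧ p.2 ∈ B)).card := by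
    intro A B hA hB
    have := hd.le_card_avoid hA hB F
    have h' : (q : ℝ) ≤ (P.filter (fun p => p.1 ∈ A ∧ p.2 ∈ B)).card + 2 * (F.card * n) := by
      rw [hP, filter_filter]
      exact_mod_cast this
    linarith
  have hcount : ∀ t : Fin n × Fin n × Fin n, β * (n : ℝ) ^ 2 ≤
      (P.filter (fun p => D t.2.2 p.1 t.1 ∧ D d t.2.1 p.2)).card := by
    intro t
    have := hsub _ _ (hdeg t.2.2 t.1).2 (hdeg d t.2.1).1
    simpa using this
  have hPc : (P.card : ℝ) ≤ (n : ℝ) ^ 2 := by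
    have := card_le_univ P
    rw [Fintype.card_prod, Fintype.card_fin, ← sq] at this
    exact_mod_cast this
  have hPne : P.Nonempty := by
    have h₁ := hcount (d, d, d)
    have h₂ : (0 : ℝ) < β * (n : ℝ) ^ 2 := by positivity
    have h₃ : 0 < (P.filter (fun p => D d p.1 d ∧ D d d p.2)).card := by
      exact_mod_cast h₂.trans_le h₁
    obtain ⟨p, hp⟩ := card_pos.1 h₃
    exact ⟨p, (mem_filter.1 hp).1⟩
  have hswap : ∑ p ∈ P, ((U.filter (fun t => D t.2.2 p.1 t.1 ∧ D d t.2.1 p.2)).card : ℝ) =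
      ∑ t ∈ U, ((P.filter (fun p => D t.2.2 p.1 t.1 ∧ D d t.2.1 p.2)).card : ℝ) := by
    exact_mod_cast sum_card_bipartiteAbove_eq_sum_card_bipartiteBelow
      (fun (p : Fin n × Fin n) (t : Fin n × Fin n × Fin n) => D t.2.2 p.1 t.1 ∧ D d t.2.1 p.2)
  have hsum : ∑ p ∈ P, (β * U.card : ℝ) ≤
      ∑ p ∈ P, ((U.filter (fun t => D t.2.2 p.1 t.1 ∧ D d t.2.1 p.2)).card : ℝ) := by
    rw [hswap]
    calc ∑ p ∈ P, (β * U.card : ℝ) = P.card * (β * U.card) := by rw [sum_const, nsmul_eq_mul]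
      _ ≤ (n : ℝ) ^ 2 * (β * U.card) := by gcongr
      _ = ∑ t ∈ U, β * (n : ℝ) ^ 2 := by rw [sum_const, nsmul_eq_mul]; ring
      _ ≤ _ := sum_le_sum fun t _ => hcount t
  obtain ⟨p, hp, hpU⟩ := exists_le_of_sum_le hPne hsum
  obtain ⟨h₁, h₂, h₃⟩ := (mem_filter.1 hp).2
  refine ⟨p.1, p.2, h₁, h₂, h₃, ?_⟩
  have := card_filter_add_card_filter_not (s := U) (fun t => D t.2.2 p.1 t.1 ∧ D d t.2.1 p.2)
  have h₄ : ((U.filter (fun t => D t.2.2 p.1 t.1 ∧ D d t.2.1 p.2)).card : ℝ) +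
      (U.filter (fun t => ¬ (D t.2.2 p.1 t.1 ∧ D d t.2.1 p.2))).card = U.card := by
    exact_mod_cast this
  linarith

lemma exists_connection {k q : ℕ} (hdeg : MinSemidegree D k) {c : Fin n}
    (hc : DenseBetween (D c) k q) (F : Finset (Fin n)) (hq : 2 * (F.card * n) < q)
    (i j y h : Fin n) : ∃ u v, u ∉ F ∧ v ∉ F ∧ D i y u ∧ D c u v ∧ D j v h := by
  have := hc.le_card_avoid (hdeg i y).1 (hdeg j h).2 F
  obtain ⟨p, hp⟩ := card_pos.1 (show 0 < (univ.filter (fun p : Fin n × Fin n =>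
      (p.1 ∉ F ∧ p.2 ∉ F ∧ D c p.1 p.2) ∧ p.1 ∈ univ.filter (fun w => D i y w) ∧
        p.2 ∈ univ.filter (fun w => D j w h))).card by omega)
  simp only [mem_filter, mem_univ, true_and] at hp
  exact ⟨p.1, p.2, hp.1.1, hp.1.2.1, hp.2.1, hp.1.2.2, hp.2.2⟩

lemma exists_notMem_of_length_lt {α : Type*} {N : Finset α} {l : List α}
    (h : l.length < N.card) : ∃ d ∈ N, d ∉ l := by
  by_contra! hcon
  have h₁ : N ⊆ l.toFinset := fun d hd => List.mem_toFinset.2 (hcon d hd)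
  exact absurd (card_le_card h₁) (by have := l.toFinset_card_le; omega)

lemma RainbowPath.exists_extend {k q m : ℕ} {β : ℝ} (hβ : 0 < β) (hloop : ∀ i v, ¬ D i v v)
    (hdeg : MinSemidegree D k) (hN : ∀ c ∈ N, DenseBetween (D c) k q) (hm : m ≤ N.card)
    (hq : β * (n : ℝ) ^ 2 + 2 * (m + 3) * n ≤ q) {h : Fin n}
    {l₀ l : List (Fin n × Fin n × Fin n)} (hl : RainbowPath D N h (l₀ ++ l))
    (hlen : (l₀ ++ l).length + 4 ≤ m) :
    ∃ h' l₁, RainbowPath D N h' (l₁ ++ l) ∧ l₁.length = l₀.length + 4 ∧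
      ((unabsorbed D l₁).card : ℝ) ≤ (1 - β) * (unabsorbed D l₀).card := by
  obtain ⟨j, hj, hjl⟩ := exists_notMem_of_length_lt (N := N)
    (l := (l₀ ++ l).map (fun e => e.2.1)) (by rw [List.length_map]; omega)
  obtain ⟨c, hc, hcl⟩ := exists_notMem_of_length_lt (N := N)
    (l := j :: (l₀ ++ l).map (fun e => e.2.1)) (by rw [List.length_cons, List.length_map]; omega)
  obtain ⟨i, hi, hil⟩ := exists_notMem_of_length_lt (N := N)
    (l := c :: j :: (l₀ ++ l).map (fun e => e.2.1))
    (by simp only [List.length_cons, List.length_map]; omega)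
  obtain ⟨d, hd, hdl⟩ := exists_notMem_of_length_lt (N := N)
    (l := i :: c :: j :: (l₀ ++ l).map (fun e => e.2.1))
    (by simp only [List.length_cons, List.length_map]; omega)
  set W := (h :: (l₀ ++ l).map (fun e => e.2.2)).toFinset with hW
  have hWc : W.card + 2 ≤ m + 3 := by
    have := (h :: (l₀ ++ l).map (fun e => e.2.2)).toFinset_card_le
    rw [List.length_cons, List.length_map, ← hW] at this
    omega
  have hn : 0 < n := h.pos
  obtain ⟨x, y, hxW, hyW, hxy, hU⟩ := exists_absorbing_edge hβ hdeg (hN d hd) W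
    (le_trans (by
      have : (W.card : ℝ) ≤ m + 3 := by
        have : W.card ≤ m + 3 := by omega
        exact_mod_cast this
      gcongr) hq) (unabsorbed D l₀)
  have hF : (W ∪ {x, y}).card ≤ m + 3 :=
    (card_union_le _ _).trans (le_trans (add_le_add le_rfl card_le_two) hWc)
  have hq' : 2 * ((W ∪ {x, y}).card * n) < q := by
    have h₁ : ((W ∪ {x, y}).card : ℝ) ≤ m + 3 := by exact_mod_cast hF
    have h₂ : (0 : ℝ) < β * (n : ℝ) ^ 2 := by positivity
    have h₃ : (2 * ((W ∪ {x, y}).card * n) : ℝ) < q := by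
      have : ((W ∪ {x, y}).card : ℝ) * n ≤ (m + 3) * n := by gcongr
      linarith
    exact_mod_cast h₃
  obtain ⟨u, v, huF, hvF, hyu, huv, hvh⟩ :=
    exists_connection hdeg (hN c hc) (W ∪ {x, y}) hq' i j y h
  have hxy' : x ≠ y := fun e => hloop d y (e ▸ hxy)
  have huv' : u ≠ v := fun e => hloop c v (e ▸ huv)
  simp only [hW, mem_union, mem_insert, mem_singleton, List.mem_toFinset, List.mem_cons,
    not_or] at hxW hyW huF hvF
  simp only [List.mem_cons, not_or] at hcl hil hdl
  refine ⟨x, (x, d, y) :: (y, i, u) :: (u, c, v) :: (v, j, h) :: l₀, ?_, by simp, ?_⟩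
  · refine .cons hxy hd ?_ ?_ (.cons hyu hi ?_ ?_ (.cons huv hc ?_ ?_ (.cons hvh hj hjl ?_ hl)))
    all_goals
      simp only [List.append_eq, List.cons_append, List.map_cons, List.mem_cons, not_or]
    · exact hdl
    · exact ⟨hxy', fun e => huF.2.1 e.symm, fun e => hvF.2.1 e.symm, hxW⟩
    · exact hil
    · exact ⟨fun e => huF.2.2 e.symm, fun e => hvF.2.2 e.symm, hyW⟩
    · exact hcl
    · exact ⟨huv', huF.1⟩
    · exact hvF.1
  · refine le_trans ?_ hU
    have : unabsorbed D ((x, d, y) :: (y, i, u) :: (u, c, v) :: (v, j, h) :: l₀) ⊆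
        (unabsorbed D l₀).filter (fun t => ¬ (D t.2.2 x t.1 ∧ D d t.2.1 y)) := by
      intro t ht
      simp only [unabsorbed, mem_filter, mem_univ, true_and, List.mem_cons, not_exists,
        not_and] at ht ⊢
      exact ⟨fun e he => ht e (by simp [he]), fun h₁ => ht (x, d, y) (by simp) h₁⟩
    exact_mod_cast card_le_card this

lemma RainbowPath.exists_block {k q m : ℕ} {β : ℝ} (hβ : 0 < β) (hβ1 : β ≤ 1)
    (hloop : ∀ i v, ¬ D i v v)
    (hdeg : MinSemidegree D k) (hN : ∀ c ∈ N, DenseBetween (D c) k q) (hm : m ≤ N.card)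
    (hq : β * (n : ℝ) ^ 2 + 2 * (m + 3) * n ≤ q) {h : Fin n}
    {l : List (Fin n × Fin n × Fin n)} (hl : RainbowPath D N h l) {t : ℕ}
    (hlen : l.length + 4 * t ≤ m) (ht : (n : ℝ) ^ 3 * (1 - β) ^ t < 1) :
    ∃ h' l₁, RainbowPath D N h' (l₁ ++ l) ∧ l₁.length = 4 * t ∧ AbsorbsAll D l₁ := by
  have key : ∀ s ≤ t, ∃ h' l₁, RainbowPath D N h' (l₁ ++ l) ∧ l₁.length = 4 * s ∧
      ((unabsorbed D l₁).card : ℝ) ≤ (n : ℝ) ^ 3 * (1 - β) ^ s := by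
    intro s
    induction s with
    | zero =>
      refine fun _ => ⟨h, [], hl, rfl, ?_⟩
      have := card_le_univ (unabsorbed D [])
      rw [Fintype.card_prod, Fintype.card_prod, Fintype.card_fin] at this
      have h' : ((unabsorbed D []).card : ℝ) ≤ n * (n * n) := by exact_mod_cast this
      rw [pow_zero]
      linarith
    | succ s ih =>
      intro hs
      obtain ⟨h', l₁, hl₁, hlen₁, hc⟩ := ih (by omega)
      obtain ⟨h'', l₂, hl₂, hlen₂, hc₂⟩ := hl₁.exists_extend hβ hloop hdeg hN hm hq
        (by rw [List.length_append]; omega)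
      refine ⟨h'', l₂, hl₂, by omega, hc₂.trans ?_⟩
      have := mul_le_mul_of_nonneg_left hc (sub_nonneg.2 hβ1)
      rw [pow_succ (1 - β)]
      linarith
  obtain ⟨h', l₁, hl₁, hlen₁, hc⟩ := key t le_rfl
  refine ⟨h', l₁, hl₁, hlen₁, fun a b c => ?_⟩
  have h0 : (unabsorbed D l₁).card = 0 := by
    have : ((unabsorbed D l₁).card : ℝ) < 1 := hc.trans_lt ht
    exact Nat.lt_one_iff.1 (by exact_mod_cast this)
  have : (a, b, c) ∉ unabsorbed D l₁ := by simp [card_eq_zero.1 h0]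
  simpa [unabsorbed] using this

lemma exists_absorbing_path {k q m : ℕ} {β : ℝ} (hβ : 0 < β) (hβ1 : β ≤ 1)
    (hloop : ∀ i v, ¬ D i v v) (hn : 0 < n)
    (hdeg : MinSemidegree D k) (hN : ∀ c ∈ N, DenseBetween (D c) k q) (hm : m ≤ N.card)
    (hq : β * (n : ℝ) ^ 2 + 2 * (m + 3) * n ≤ q) {t : ℕ} (ht : (n : ℝ) ^ 3 * (1 - β) ^ t < 1)
    (r : ℕ) (hlen : 4 * t * r ≤ m) :
    ∃ h l, RainbowPath D N h l ∧ l.length = 4 * t * r ∧ AbsorbsTimes D r l := by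
  induction r with
  | zero => exact ⟨⟨0, hn⟩, [], .nil _, by simp, trivial⟩
  | succ r ih =>
    rw [Nat.mul_succ] at hlen
    obtain ⟨h, l, hl, hlen₁, hab⟩ := ih (by omega)
    obtain ⟨h', l₁, hl₁, hlen₂, hab₁⟩ := hl.exists_block hβ hβ1 hloop hdeg hN hm hq
      (t := t) (by omega) ht
    exact ⟨h', l₁ ++ l, hl₁, by rw [List.length_append, Nat.mul_succ]; omega,
      l₁, l, rfl, hab₁, hab⟩

lemma AbsorbsTimes.mono {r s : ℕ} (hrs : r ≤ s) {l : List (Fin n × Fin n × Fin n)}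
    (h : AbsorbsTimes D s l) : AbsorbsTimes D r l := by
  induction s generalizing r l with
  | zero => rw [Nat.le_zero.1 hrs]; trivial
  | succ s ih =>
    cases r with
    | zero => trivial
    | succ r =>
      obtain ⟨l₁, l₂, rfl, h₁, h₂⟩ := h
      exact ⟨l₁, l₂, rfl, h₁, ih (by omega) h₂⟩

lemma exists_perm_getElem {l : List (Fin n)} (hl : l.Nodup) :
    ∃ τ : Equiv.Perm (Fin n), ∀ (i : ℕ) (hi : i < l.length) (hi' : i < n), τ ⟨i, hi'⟩ = l[i] := by
  have hlen : l.length ≤ n := by simpa using hl.length_le_card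
  obtain ⟨τ, hτ⟩ := Equiv.Perm.exists_extending_pair
    (fun i : Fin l.length => Fin.castLE hlen i) (fun i : Fin l.length => l.get i)
    (Fin.castLE_injective hlen) (List.nodup_iff_injective_get.1 hl)
  exact ⟨τ, fun i hi hi' => hτ ⟨i, hi⟩⟩

lemma longCycles_finRotate {L : ℕ} (hL : L ≤ n) : LongCycles L (finRotate n) := by
  intro v j hj hjL hv
  have hn : 2 ≤ n := by omega
  have hne : finRotate n v ≠ v :=
    Equiv.Perm.mem_support.1 (by rw [support_finRotate_of_le hn]; exact mem_univ v)
  have hc := isCycle_finRotate_of_le hn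
  have hone := (hc.pow_eq_one_iff).2 ⟨v, hne, hv⟩
  have hdvd := orderOf_dvd_of_pow_eq_one hone
  rw [hc.orderOf, support_finRotate_of_le hn, card_univ, Fintype.card_fin] at hdvd
  exact absurd (Nat.le_of_dvd hj hdvd) (by omega)

lemma LongCycles.conj {α : Type*} {L : ℕ} {π : Equiv.Perm α} (h : LongCycles L π)
    (τ : Equiv.Perm α) : LongCycles L (τ * π * τ⁻¹) := by
  intro v j hj hjL hv
  rw [conj_pow] at hv
  apply h (τ⁻¹ v) j hj hjL
  rw [Equiv.Perm.eq_inv_iff_eq]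
  simpa using hv

lemma RainbowPath.exists_partialFactor {L : ℕ} (hL : L ≤ n) {h : Fin n}
    {l : List (Fin n × Fin n × Fin n)} (hl : RainbowPath D N h l) :
    ∃ π φ : Equiv.Perm (Fin n), (∀ e ∈ l, π e.1 = e.2.2 ∧ φ e.1 = e.2.1) ∧
      PartialFactor D L (l.map Prod.fst).toFinset π φ (univ \ (l.map Prod.fst).toFinset) π φ := by
  obtain ⟨τ, hτ⟩ := exists_perm_getElem hl.nodup_vertices
  obtain ⟨ρ, hρ⟩ := exists_perm_getElem hl.nodup_colours
  have hlen : l.length + 1 ≤ n := by simpa using hl.nodup_vertices.length_le_card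
  have key : ∀ e ∈ l, (τ * finRotate n * τ⁻¹) e.1 = e.2.2 ∧ (ρ * τ⁻¹) e.1 = e.2.1 := by
    intro e he
    obtain ⟨i, hi, rfl⟩ := List.mem_iff_getElem.1 he
    have htail : (h :: l.map (fun e => e.2.2))[i]'(by simp; omega) = l[i].1 := by
      have := hl.tails_prefix.getElem (i := i) (by simpa using hi)
      simpa using this.symm
    have h₁ : τ⁻¹ l[i].1 = ⟨i, by omega⟩ := by
      rw [Equiv.Perm.inv_eq_iff_eq, hτ i (by simp; omega), htail]
    constructor
    · rw [Equiv.Perm.mul_apply, Equiv.Perm.mul_apply, h₁]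
      have h₂ : finRotate n ⟨i, by omega⟩ = ⟨i + 1, by omega⟩ := by
        obtain ⟨n, rfl⟩ : ∃ m, n = m + 1 := ⟨n - 1, by omega⟩
        exact finRotate_of_lt (by omega)
      rw [h₂, hτ (i + 1) (by simpa using hi)]
      simp
    · rw [Equiv.Perm.mul_apply, h₁, hρ i (by simpa using hi)]
      simp
  refine ⟨_, _, key, fun v hv => ?_, fun z hz => ⟨by simpa using hz, rfl, rfl⟩,
    (longCycles_finRotate hL).conj τ⟩
  rw [mem_sdiff, not_and_not_right] at hv
  obtain ⟨e, he, rfl⟩ := List.mem_map.1 (List.mem_toFinset.1 (hv (mem_univ v)))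
  rw [(key e he).1, (key e he).2]
  exact (hl.good e he).1

end AbsorbingPath

section Main

variable {n : ℕ} {D : Fin n → Fin n → Fin n → Prop} {N : Finset (Fin n)}

lemma exists_hamilton_of_denseBetween {k q L M s t : ℕ} {β : ℝ} (hβ : 0 < β) (hβ1 : β ≤ 1)
    (hn : 2 ≤ n) (hL : 0 < L) (hLn : L ≤ n) (hs : n ≤ s * L) (hloop : ∀ i v, ¬ D i v v)
    (hdeg : MinSemidegree D k) (hdense : ∀ c ∈ N, DenseBetween (D c) k q)
    (hN : 4 * t * (s + 6) + M ≤ N.card)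
    (hcard : n + 2 * (4 * t * (s + 6) + 2 * L + 2) < 2 * k + (M + 2))
    (hq : β * (n : ℝ) ^ 2 + 2 * ((4 * t * (s + 6) : ℕ) + 3) * n ≤ q)
    (hq' : 2 * (n * (4 * t * (s + 6) + 2 * L + 3)) < q)
    (ht : (n : ℝ) ^ 3 * (1 - β) ^ t < 1) :
    ∃ σ ψ : Fin n ≃ Fin n, ∀ k : Fin n, D (ψ k) (σ k) (σ (finRotate n k)) := by
  obtain ⟨h, l, hl, hlen, hab⟩ := exists_absorbing_path hβ hβ1 hloop (by omega) hdeg hdense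
    (m := 4 * t * (s + 6)) (by omega) hq ht (s + 6) le_rfl
  obtain ⟨π₀, φ₀, hfr, hT₀⟩ := hl.exists_partialFactor hLn
  set Z := (l.map Prod.fst).toFinset with hZ
  set N' := N \ (l.map (fun e => e.2.1)).toFinset with hN'
  have hZc : Z.card = 4 * t * (s + 6) := by
    rw [hZ, List.toFinset_card_of_nodup hl.nodup_tails, List.length_map, hlen]
  have hN'c : M ≤ N'.card := by
    have h₁ := le_card_sdiff (l.map (fun e => e.2.1)).toFinset N
    rw [List.toFinset_card_of_nodup hl.nodup_colours, List.length_map, hlen, ← hN'] at h₁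
    omega
  have hmem : ∀ e ∈ l, e.1 ∈ Z := fun e he =>
    List.mem_toFinset.2 (List.mem_map_of_mem he)
  obtain ⟨S₁, π₁, φ₁, hT₁, hS₁⟩ := hT₀.exists_reserved hdeg (N := N') (by
    intro c hc
    rw [mem_sdiff, and_iff_right (mem_univ _)]
    intro hcZ
    obtain ⟨e, he, hec⟩ := List.mem_map.1 (List.mem_toFinset.1 hcZ)
    apply (mem_sdiff.1 hc).2
    rw [← φ₀.apply_symm_apply c, ← hec, (hfr e he).2]
    exact List.mem_toFinset.2 (List.mem_map_of_mem (f := fun e => e.2.1) he)) (by omega)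
  obtain ⟨S, π, φ, hT, hS⟩ := hT₁.exists_card_le_two hL hdeg (N := N')
    (fun c hc => hdense c (mem_sdiff.1 hc).1) (by rwa [hZc]) hS₁
  have hpath : PathOf π φ l := by
    refine ⟨fun e he => ?_, hl.nodup_tails, hl.isChain⟩
    rw [(hT.frozen _ (hmem e he)).2.1, (hT.frozen _ (hmem e he)).2.2]
    exact hfr e he
  obtain ⟨R, hR, hRc⟩ := hT.long.exists_meetsCycles
  rw [Fintype.card_fin] at hRc
  have hRs : R.card ≤ s := Nat.le_of_mul_le_mul_right (hRc.trans hs) hL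
  obtain ⟨π', φ', l', R', hg', hpath', hab', hR', hR'c⟩ := exists_fill (r := s + 4) hT.good hpath
    (fun e he => (hT.frozen _ (hmem e he)).1) (hab.mono (by omega)) hR
  obtain ⟨π'', φ'', hg'', hcyc⟩ := exists_merge hg' hpath' hab' hR' (by omega)
  exact exists_hamilton_of_sameCycle hn hg'' hcyc

lemma minSemidegree_of_outDeg_inDeg {c : ℝ}
    (h : ∀ i v, c ≤ outDeg (D i) v ∧ c ≤ inDeg (D i) v) : MinSemidegree D ⌈c⌉₊ := by
  intro i v
  have h₁ := h i v
  rw [outDeg, inDeg, Nat.card_eq_fintype_card, Nat.card_eq_fintype_card, Fintype.card_subtype,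
    Fintype.card_subtype] at h₁
  exact ⟨Nat.ceil_le.2 h₁.1, Nat.ceil_le.2 h₁.2⟩

lemma niceDi.denseBetween {α c : ℝ} {G : Fin n → Fin n → Prop} (h : niceDi α G)
    (hc : (1 / 2 - α) * n ≤ c) : DenseBetween G ⌈c⌉₊ ⌈α * (n : ℝ) ^ 2⌉₊ := by
  intro A B hA hB
  have h₁ := h A B (hc.trans (Nat.ceil_le.1 hA)) (hc.trans (Nat.ceil_le.1 hB))
  rw [eDi, Nat.card_eq_fintype_card, Fintype.card_subtype] at h₁
  exact Nat.ceil_le.2 h₁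

lemma eventually_pow_mul_pow_floor_lt_one {ρ c : ℝ} (hρ : 0 < ρ) (hρ1 : ρ < 1) (hc : 0 < c) :
    ∀ᶠ n : ℕ in Filter.atTop, (n : ℝ) ^ 3 * ρ ^ ⌊c * n⌋₊ < 1 := by
  have h₁ := tendsto_pow_const_mul_const_pow_of_abs_lt_one 3 (abs_lt.2 ⟨by linarith, hρ1⟩)
  have h₂ : Filter.Tendsto (fun n : ℕ => ⌊c * n⌋₊ + 1) Filter.atTop Filter.atTop :=
    (Filter.tendsto_add_atTop_nat 1).comp (tendsto_nat_floor_atTop.comp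
      (tendsto_natCast_atTop_atTop.const_mul_atTop hc))
  filter_upwards [(h₁.comp h₂).eventually_lt_const (show 0 < ρ * c ^ 3 by positivity)] with n hn
  simp only [Function.comp_apply] at hn
  push_cast at hn
  have h₃ : (c * n) ^ 3 ≤ ((⌊c * n⌋₊ : ℝ) + 1) ^ 3 := by
    gcongr
    exact (Nat.lt_floor_add_one _).le
  have h₄ : ρ * c ^ 3 * ((n : ℝ) ^ 3 * ρ ^ ⌊c * n⌋₊) < ρ * c ^ 3 * 1 := by
    calc ρ * c ^ 3 * ((n : ℝ) ^ 3 * ρ ^ ⌊c * n⌋₊)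
        = (c * n) ^ 3 * ρ ^ (⌊c * n⌋₊ + 1) := by ring
      _ ≤ ((⌊c * n⌋₊ : ℝ) + 1) ^ 3 * ρ ^ (⌊c * n⌋₊ + 1) := by gcongr
      _ < ρ * c ^ 3 * 1 := by rwa [mul_one]
  exact lt_of_mul_lt_mul_left h₄ (by positivity)

end Main

/-- **Strongly stable case.**  For `0 < 1/n ≪ μ ≪ α ≪ γ ≪ 1`: if
`𝒟 = {D 1, …, D n}` is a collection of loopless digraphs on a common vertex set of size
`n` with minimum semi-degree at least `(1/2 − μ)n` and at least `γn` of the digraphs are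
`α`-nice, then `𝒟` contains a transversal directed Hamilton cycle. -/
theorem strongly_stable_hamilton (γ : ℝ) (hγ : 0 < γ) (hγ1 : γ ≤ 1) :
    ∃ α0 : ℝ, 0 < α0 ∧ ∀ α : ℝ, 0 < α → α ≤ α0 →
    ∃ μ0 : ℝ, 0 < μ0 ∧ ∀ μ : ℝ, 0 < μ → μ ≤ μ0 →
    ∃ n0 : ℕ, ∀ n : ℕ, n0 ≤ n →
    ∀ D : Fin n → Fin n → Fin n → Prop,
    (∀ i v, ¬ D i v v) →
    (∀ i v, (1/2 - μ) * (n : ℝ) ≤ outDeg (D i) v ∧ (1/2 - μ) * (n : ℝ) ≤ inDeg (D i) v) →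
    (γ * (n : ℝ) ≤ ((univ.filter (fun i : Fin n => niceDi α (D i))).card : ℝ)) →
    ∃ σ φ : Fin n ≃ Fin n, ∀ k : Fin n, D (φ k) (σ k) (σ (finRotate n k)) := by
  refine ⟨1, one_pos, fun α hα hα1 => ⟨min α γ / 40, by positivity, fun μ hμ hμ0 => ?_⟩⟩
  have hμα : 40 * μ ≤ α := by linarith [min_le_left α γ]
  have hμγ : 40 * μ ≤ γ := by linarith [min_le_right α γ]
  set s := ⌈1 / μ⌉₊ with hs
  have hsμ : 1 ≤ s * μ := (div_le_iff₀ hμ).1 (Nat.le_ceil _)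
  set c := μ / (4 * (s + 6)) with hc
  have hc0 : 0 < c := by positivity
  have hlarge : ∀ᶠ n : ℕ in Filter.atTop, 10 ≤ μ * (n : ℝ) :=
    (tendsto_natCast_atTop_atTop.const_mul_atTop hμ).eventually_ge_atTop 10
  obtain ⟨n₀, hn₀⟩ := Filter.eventually_atTop.1 ((eventually_pow_mul_pow_floor_lt_one
    (show 0 < 1 - α / 2 by linarith) (by linarith) hc0).and hlarge)
  refine ⟨n₀, fun n hn D hloop hdeg hnice => ?_⟩
  obtain ⟨ht, hμn⟩ := hn₀ n hn
  set t := ⌊c * n⌋₊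
  have hn10 : (10 : ℝ) ≤ n := by nlinarith
  have hm : ((4 * t * (s + 6) : ℕ) : ℝ) ≤ μ * n := by
    have h₁ : (t : ℝ) ≤ c * n := Nat.floor_le (by positivity)
    calc ((4 * t * (s + 6) : ℕ) : ℝ) = 4 * (s + 6) * t := by push_cast; ring
      _ ≤ 4 * (s + 6) * (c * n) := by gcongr
      _ = μ * n := by rw [hc]; field_simp
  have hL : μ * n ≤ ⌈μ * (n : ℝ)⌉₊ := Nat.le_ceil _
  have hL' : (⌈μ * (n : ℝ)⌉₊ : ℝ) < μ * n + 1 := Nat.ceil_lt_add_one (by positivity)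
  have hM : 20 * (μ * n) ≤ ⌈20 * (μ * (n : ℝ))⌉₊ := Nat.le_ceil _
  have hM' : (⌈20 * (μ * (n : ℝ))⌉₊ : ℝ) < 20 * (μ * n) + 1 :=
    Nat.ceil_lt_add_one (by positivity)
  have hk : (1 / 2 - μ) * n ≤ ⌈(1 / 2 - μ) * (n : ℝ)⌉₊ := Nat.le_ceil _
  have hq : α * (n : ℝ) ^ 2 ≤ ⌈α * (n : ℝ) ^ 2⌉₊ := Nat.le_ceil _
  have hμα' : 40 * (μ * n) * n ≤ α * (n : ℝ) ^ 2 := by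
    calc 40 * (μ * n) * n = 40 * μ * (n : ℝ) ^ 2 := by ring
      _ ≤ _ := by gcongr
  refine exists_hamilton_of_denseBetween (β := α / 2) (k := ⌈(1 / 2 - μ) * (n : ℝ)⌉₊)
    (q := ⌈α * (n : ℝ) ^ 2⌉₊) (L := ⌈μ * (n : ℝ)⌉₊) (M := ⌈20 * (μ * (n : ℝ))⌉₊) (s := s) (t := t)
    (N := univ.filter (fun i : Fin n => niceDi α (D i)))
    (by positivity) (by linarith) ?_ ?_ ?_ ?_ hloop (minSemidegree_of_outDeg_inDeg hdeg) ?_ ?_ ?_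
    ?_ ?_ ht
  · have : (2 : ℝ) ≤ n := by linarith
    exact_mod_cast this
  · exact Nat.ceil_pos.2 (by positivity)
  · refine Nat.ceil_le.2 ?_
    nlinarith
  · have : (n : ℝ) ≤ s * ⌈μ * (n : ℝ)⌉₊ := by
      calc (n : ℝ) ≤ s * μ * n := le_mul_of_one_le_left (by positivity) hsμ
        _ = s * (μ * n) := by ring
        _ ≤ _ := by gcongr
    exact_mod_cast this
  · intro i hi
    refine (mem_filter.1 hi).2.denseBetween ?_
    gcongr
    linarith
  · have : ((4 * t * (s + 6) : ℕ) : ℝ) + ⌈20 * (μ * (n : ℝ))⌉₊ ≤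
        ((univ.filter (fun i : Fin n => niceDi α (D i))).card : ℝ) := by
      have : 40 * (μ * n) ≤ γ * n := by rw [← mul_assoc]; gcongr
      linarith
    exact_mod_cast this
  · have : (n : ℝ) + 2 * (((4 * t * (s + 6) : ℕ) : ℝ) + 2 * ⌈μ * (n : ℝ)⌉₊ + 2) <
        2 * ⌈(1 / 2 - μ) * (n : ℝ)⌉₊ + (⌈20 * (μ * (n : ℝ))⌉₊ + 2) := by
      linarith
    exact_mod_cast this
  · have : 2 * (((4 * t * (s + 6) : ℕ) : ℝ) + 3) * n ≤ 20 * (μ * n) * n := by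
      refine mul_le_mul_of_nonneg_right ?_ (by positivity)
      linarith
    linarith
  · have : (2 : ℝ) * (n * (((4 * t * (s + 6) : ℕ) : ℝ) + 2 * ⌈μ * (n : ℝ)⌉₊ + 3)) <
        ⌈α * (n : ℝ) ^ 2⌉₊ := by
      have h₁ : ((4 * t * (s + 6) : ℕ) : ℝ) + 2 * ⌈μ * (n : ℝ)⌉₊ + 3 < 20 * (μ * n) := by linarith
      have h₂ := mul_lt_mul_of_pos_left h₁ (show (0 : ℝ) < n by linarith)
      linarith
    exact_mod_cast this
end
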